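/- arXiv:1902.05876 — 3 statements merged into one kernel-verified Lean document; each statement's English description precedes it below -/
import Mathlib

section
/- (Explicit sample complexity for the improper upper bound.) There exists a universal constant C > 0 with the following property. For every d ≥ 1, every finite class Q = {q_1, …, q_n} of Borel probability measures on ℝ^d, every ε, δ ∈ (0,1), and every m ≥ C·(n + log(1/δ))/ε², there exists a measurable map A from (ℝ^d)^m to the space of Borel probability measures on ℝ^d such that for every Borel probability measure p on ℝ^d, p^{⊗m}({ S : TV(A(S), p) ≤ 2 · min_{1 ≤ i ≤ n} TV(p, q_i) + ε }) ≥ 1 − δ. -/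
open MeasureTheory

/-- Total variation distance between two measures. -/
noncomputable def tv {X : Type*} [MeasurableSpace X] (p q : Measure X) : ℝ :=
  ⨆ A : {A : Set X // MeasurableSet A}, |(p A.1).toReal - (q A.1).toReal|

section TotalVariation

variable {X : Type*} [MeasurableSpace X]

lemma tv_bddAbove (p q : Measure X) [IsProbabilityMeasure p] [IsProbabilityMeasure q] :
    BddAbove (Set.range fun A : {A : Set X // MeasurableSet A} =>
      |(p A.1).toReal - (q A.1).toReal|) := by
  refine ⟨1, ?_⟩
  rintro _ ⟨A, rfl⟩
  have h1 : p.real A.1 ≤ 1 := measureReal_le_one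
  have h2 : q.real A.1 ≤ 1 := measureReal_le_one
  have h3 : 0 ≤ p.real A.1 := measureReal_nonneg
  have h4 : 0 ≤ q.real A.1 := measureReal_nonneg
  exact abs_le.2 ⟨by change _ ≤ p.real A.1 - q.real A.1; linarith,
    by change p.real A.1 - q.real A.1 ≤ _; linarith⟩

lemma abs_sub_le_tv (p q : Measure X) [IsProbabilityMeasure p] [IsProbabilityMeasure q]
    {A : Set X} (hA : MeasurableSet A) : |p.real A - q.real A| ≤ tv p q :=
  le_ciSup (tv_bddAbove p q) ⟨A, hA⟩

lemma sub_le_tv (p q : Measure X) [IsProbabilityMeasure p] [IsProbabilityMeasure q]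
    {A : Set X} (hA : MeasurableSet A) : p.real A - q.real A ≤ tv p q :=
  (le_abs_self _).trans (abs_sub_le_tv p q hA)

lemma tv_nonneg (p q : Measure X) : 0 ≤ tv p q :=
  Real.iSup_nonneg fun _ => abs_nonneg _

lemma tv_comm (p q : Measure X) : tv p q = tv q p := by
  simp only [tv, abs_sub_comm]

/-- For probability measures a one-sided bound over all events suffices. -/
lemma tv_le_of_forall_sub_le {p q : Measure X} [IsProbabilityMeasure p] [IsProbabilityMeasure q]
    {r : ℝ} (h : ∀ A, MeasurableSet A → p.real A - q.real A ≤ r) : tv p q ≤ r := by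
  have : Nonempty {A : Set X // MeasurableSet A} := ⟨⟨∅, MeasurableSet.empty⟩⟩
  refine ciSup_le fun A => abs_le.2 ⟨?_, h A.1 A.2⟩
  have h1 := h A.1ᶜ A.2.compl
  rw [probReal_compl_eq_one_sub A.2, probReal_compl_eq_one_sub A.2] at h1
  change -r ≤ p.real A.1 - q.real A.1
  linarith

lemma tv_le_one (p q : Measure X) [IsProbabilityMeasure p] [IsProbabilityMeasure q] :
    tv p q ≤ 1 := by
  refine tv_le_of_forall_sub_le fun A _ => ?_
  have h1 : p.real A ≤ 1 := measureReal_le_one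
  have h4 : 0 ≤ q.real A := measureReal_nonneg
  linarith

lemma tv_triangle (p q r : Measure X) [IsProbabilityMeasure p] [IsProbabilityMeasure q]
    [IsProbabilityMeasure r] : tv p r ≤ tv p q + tv q r := by
  refine tv_le_of_forall_sub_le fun A hA => ?_
  have h1 := sub_le_tv p q hA
  have h2 := sub_le_tv q r hA
  linarith

lemma exists_mixture {κ : Type*} [Fintype κ] (π : κ → ℝ) (hπ : ∀ c, 0 ≤ π c)
    (hsum : ∑ c, π c = 1) (ν : κ → ProbabilityMeasure X) :
    ∃ R : ProbabilityMeasure X, ∀ A : Set X,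
      (R : Measure X).real A = ∑ c, π c * (ν c : Measure X).real A := by
  have happ : ∀ A : Set X, (∑ c, ENNReal.ofReal (π c) • (ν c : Measure X)) A =
      ∑ c, ENNReal.ofReal (π c) * (ν c : Measure X) A := by
    intro A
    simp
  refine ⟨⟨∑ c, ENNReal.ofReal (π c) • (ν c : Measure X), ⟨?_⟩⟩, fun A => ?_⟩
  · rw [happ]
    simp only [measure_univ, mul_one]
    rw [← ENNReal.ofReal_sum_of_nonneg fun c _ => hπ c, hsum, ENNReal.ofReal_one]
  · change ((∑ c, ENNReal.ofReal (π c) • (ν c : Measure X)) A).toReal = _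
    rw [happ, ENNReal.toReal_sum fun c _ =>
      ENNReal.mul_ne_top ENNReal.ofReal_ne_top (measure_ne_top _ _)]
    refine Finset.sum_congr rfl fun c _ => ?_
    rw [ENNReal.toReal_mul, ENNReal.toReal_ofReal (hπ c)]
    rfl

/-- A measurable `[0, 1]`-valued function, used as a randomized statistical test. -/
structure RandTest (X : Type*) [MeasurableSpace X] where
  toFun : X → ℝ
  measurable_toFun : Measurable toFun
  mem_Icc : ∀ x, toFun x ∈ Set.Icc (0 : ℝ) 1

namespace RandTest

lemma integrable (F : RandTest X) (p : Measure X) [IsFiniteMeasure p] : Integrable F.toFun p :=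
  Integrable.of_mem_Icc 0 1 F.measurable_toFun.aemeasurable (.of_forall F.mem_Icc)

/-- The advantage of a randomized test in telling two measures apart. -/
noncomputable def adv (F : RandTest X) (p q : Measure X) : ℝ :=
  ∫ x, F.toFun x ∂p - ∫ x, F.toFun x ∂q

lemma adv_le_tv (F : RandTest X) (p q : Measure X) [IsProbabilityMeasure p]
    [IsProbabilityMeasure q] : F.adv p q ≤ tv p q := by
  have key : ∀ μ : Measure X, IsProbabilityMeasure μ →
      IntegrableOn (fun t : ℝ => μ.real {a | t ≤ F.toFun a}) (Set.Ioc 0 1) volume := by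
    intro μ hμ
    refine Integrable.of_mem_Icc 0 1 ?_ (.of_forall fun t => ⟨measureReal_nonneg, measureReal_le_one⟩)
    refine (Antitone.measurable fun s t hst => ?_).aemeasurable
    exact measureReal_mono fun a ha => le_trans hst ha
  rw [adv, (F.integrable p).integral_eq_integral_Ioc_meas_le (M := 1)
      (.of_forall fun x => (F.mem_Icc x).1) (.of_forall fun x => (F.mem_Icc x).2),
    (F.integrable q).integral_eq_integral_Ioc_meas_le (M := 1)
      (.of_forall fun x => (F.mem_Icc x).1) (.of_forall fun x => (F.mem_Icc x).2),
    ← integral_sub (key p inferInstance) (key q inferInstance)]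
  calc _ ≤ ∫ _ in Set.Ioc (0 : ℝ) 1, tv p q := by
        refine integral_mono ((key p inferInstance).sub (key q inferInstance))
          (integrable_const _) fun t => ?_
        exact sub_le_tv p q (measurableSet_le measurable_const F.measurable_toFun)
    _ = tv p q := by simp

end RandTest

end TotalVariation

section Learnable

variable {X : Type*} [MeasurableSpace X]

/-- `Learnable m δ G`: some finitely-valued measurable statistic of `m` i.i.d. samples from an
unknown `p` satisfies the specification `G p`, except with probability at most `δ`. -/
def Learnable {O : Type*} (m : ℕ) (δ : ℝ) (G : ProbabilityMeasure X → O → Prop) : Prop :=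
  ∃ D : (Fin m → X) → O, (Set.range D).Finite ∧ (∀ s : Set O, MeasurableSet (D ⁻¹' s)) ∧
    ∀ p : ProbabilityMeasure X,
      Measure.pi (fun _ : Fin m => (p : Measure X)) {S | ¬ G p (D S)} ≤ ENNReal.ofReal δ

namespace Learnable

variable {O O₁ O₂ : Type*} {m m₁ m₂ : ℕ} {δ δ₁ δ₂ : ℝ}

lemma pure {G : ProbabilityMeasure X → O → Prop} (o : O) (h : ∀ p, G p o) :
    Learnable m δ G := by
  refine ⟨fun _ => o, Set.finite_range_const, fun s => MeasurableSet.const (o ∈ s), fun p => ?_⟩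
  simp [h p]

lemma map {G₁ : ProbabilityMeasure X → O₁ → Prop} {G₂ : ProbabilityMeasure X → O₂ → Prop}
    (h : Learnable m δ G₁) (f : O₁ → O₂) (hf : ∀ p o, G₁ p o → G₂ p (f o)) :
    Learnable m δ G₂ := by
  obtain ⟨D, hD, hm, hp⟩ := h
  refine ⟨f ∘ D, ?_, fun s => hm (f ⁻¹' s), fun p => ?_⟩
  · rw [Set.range_comp]
    exact hD.image f
  · exact (measure_mono fun S (hS : ¬ G₂ p (f (D S))) =>
      show ¬ G₁ p (D S) from fun hG => hS (hf p _ hG)).trans (hp p)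

lemma measurePreserving_split (p : Measure X) [IsProbabilityMeasure p] (m₁ m₂ : ℕ) :
    MeasurePreserving (fun S : Fin (m₁ + m₂) → X =>
        ((fun i => S (Fin.castAdd m₂ i), fun i => S (Fin.natAdd m₁ i)) :
          (Fin m₁ → X) × (Fin m₂ → X)))
      (Measure.pi fun _ => p) ((Measure.pi fun _ => p).prod (Measure.pi fun _ => p)) := by
  have h1 := (measurePreserving_piCongrLeft (fun _ : Fin (m₁ + m₂) => p)
    (finSumFinEquiv (m := m₁) (n := m₂))).symm
  have h2 := measurePreserving_sumPiEquivProdPi (fun _ : Fin m₁ ⊕ Fin m₂ => p)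
  exact h2.comp h1

/-- Sequential composition on disjoint parts of the sample. -/
lemma bind {G₁ : ProbabilityMeasure X → O₁ → Prop} {G : ProbabilityMeasure X → O₂ → Prop}
    (hδ₁ : 0 ≤ δ₁) (hδ₂ : 0 ≤ δ₂) (h₁ : Learnable m₁ δ₁ G₁)
    (h₂ : ∀ o, Learnable m₂ δ₂ fun p o₂ => G₁ p o → G p o₂) :
    Learnable (m₁ + m₂) (δ₁ + δ₂) G := by
  obtain ⟨D₁, hfin₁, hm₁, hp₁⟩ := h₁
  choose D₂ hfin₂ hm₂ hp₂ using h₂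
  let E : (Fin m₁ → X) × (Fin m₂ → X) → O₂ := fun z => D₂ (D₁ z.1) z.2
  have hmeas : ∀ t : O₁ → Set O₂, MeasurableSet
      {z : (Fin m₁ → X) × (Fin m₂ → X) | D₂ (D₁ z.1) z.2 ∈ t (D₁ z.1)} := by
    intro t
    have : {z : (Fin m₁ → X) × (Fin m₂ → X) | D₂ (D₁ z.1) z.2 ∈ t (D₁ z.1)} =
        ⋃ o ∈ Set.range D₁, (D₁ ⁻¹' {o}) ×ˢ (D₂ o ⁻¹' t o) := by
      ext z
      simp only [Set.mem_ofPred_eq, Set.mem_iUnion, Set.mem_prod, Set.mem_preimage,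
        Set.mem_singleton_iff, exists_prop]
      constructor
      · exact fun h => ⟨D₁ z.1, ⟨z.1, rfl⟩, rfl, h⟩
      · rintro ⟨o, _, rfl, h⟩
        exact h
    rw [this]
    exact MeasurableSet.biUnion hfin₁.countable fun o _ => (hm₁ {o}).prod (hm₂ o (t o))
  refine ⟨fun S => E (fun i => S (Fin.castAdd m₂ i), fun i => S (Fin.natAdd m₁ i)), ?_, ?_, ?_⟩
  · refine (hfin₁.biUnion fun o _ => hfin₂ o).subset ?_
    rintro _ ⟨S, rfl⟩
    simp only [Set.mem_iUnion, exists_prop]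
    exact ⟨D₁ fun i => S (Fin.castAdd m₂ i), ⟨_, rfl⟩, ⟨_, rfl⟩⟩
  · intro s
    have hpre := hmeas fun _ => s
    exact (show Measurable fun S : Fin (m₁ + m₂) → X =>
        ((fun i => S (Fin.castAdd m₂ i), fun i => S (Fin.natAdd m₁ i)) :
          (Fin m₁ → X) × (Fin m₂ → X)) by fun_prop) hpre
  · intro p
    set μ₁ : Measure (Fin m₁ → X) := Measure.pi fun _ => (p : Measure X)
    set μ₂ : Measure (Fin m₂ → X) := Measure.pi fun _ => (p : Measure X)
    have hbad : MeasurableSet {z : (Fin m₁ → X) × (Fin m₂ → X) | ¬ G p (E z)} :=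
      hmeas fun _ => {o | ¬ G p o}
    have hbad₂ : MeasurableSet {z : (Fin m₁ → X) × (Fin m₂ → X) |
        ¬ (G₁ p (D₁ z.1) → G p (E z))} := hmeas fun o => {o₂ | ¬ (G₁ p o → G p o₂)}
    have hsplit := (measurePreserving_split (p : Measure X) m₁ m₂).measure_preimage
      hbad.nullMeasurableSet
    change Measure.pi _ ((fun S : Fin (m₁ + m₂) → X =>
        ((fun i => S (Fin.castAdd m₂ i), fun i => S (Fin.natAdd m₁ i)) :
          (Fin m₁ → X) × (Fin m₂ → X))) ⁻¹' {z | ¬ G p (E z)}) ≤ _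
    rw [hsplit]
    calc (μ₁.prod μ₂) {z | ¬ G p (E z)}
        ≤ (μ₁.prod μ₂) ({S | ¬ G₁ p (D₁ S)} ×ˢ Set.univ ∪
            {z | ¬ (G₁ p (D₁ z.1) → G p (E z))}) := by
          refine measure_mono fun z hz => ?_
          by_cases hg : G₁ p (D₁ z.1)
          · exact Or.inr fun h => hz (h hg)
          · exact Or.inl ⟨hg, trivial⟩
      _ ≤ (μ₁.prod μ₂) ({S | ¬ G₁ p (D₁ S)} ×ˢ Set.univ) +
            (μ₁.prod μ₂) {z | ¬ (G₁ p (D₁ z.1) → G p (E z))} := measure_union_le _ _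
      _ ≤ ENNReal.ofReal δ₁ + ENNReal.ofReal δ₂ := by
          refine add_le_add ?_ ?_
          · rw [Measure.prod_prod, measure_univ, mul_one]
            exact hp₁ p
          · rw [Measure.prod_apply hbad₂]
            calc _ ≤ ∫⁻ _ : Fin m₁ → X, ENNReal.ofReal δ₂ ∂μ₁ :=
                  lintegral_mono fun S => hp₂ (D₁ S) p
              _ = ENNReal.ofReal δ₂ := by simp
      _ = ENNReal.ofReal (δ₁ + δ₂) := (ENNReal.ofReal_add hδ₁ hδ₂).symm

/-- Finitely many specifications can be met at once from the same sample. -/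
lemma forall_fintype {ι : Type*} [Fintype ι] {G : ι → ProbabilityMeasure X → O → Prop}
    (h : ∀ i, Learnable m δ (G i)) :
    Learnable m (Fintype.card ι * δ) fun p (o : ι → O) => ∀ i, G i p (o i) := by
  choose D hfin hmeas hp using h
  have hrange : (Set.range fun S i => D i S).Finite := by
    refine (Set.Finite.pi' hfin).subset ?_
    rintro _ ⟨S, rfl⟩ i
    exact ⟨S, rfl⟩
  refine ⟨fun S i => D i S, hrange, fun s => ?_, fun p => ?_⟩
  · have : (fun S i => D i S) ⁻¹' s =
        ⋃ o ∈ s ∩ Set.range (fun S i => D i S), ⋂ i, D i ⁻¹' {o i} := by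
      ext S
      simp only [Set.mem_preimage, Set.mem_iUnion, Set.mem_iInter, Set.mem_singleton_iff,
        exists_prop]
      constructor
      · exact fun h => ⟨_, ⟨h, S, rfl⟩, fun i => rfl⟩
      · rintro ⟨o, ⟨ho, -⟩, h⟩
        rwa [show (fun i => D i S) = o from funext h]
    rw [this]
    exact MeasurableSet.biUnion (hrange.subset Set.inter_subset_right).countable
      fun o _ => MeasurableSet.iInter fun i => hmeas i _
  · calc _ ≤ Measure.pi (fun _ : Fin m => (p : Measure X)) (⋃ i, {S | ¬ G i p (D i S)}) := by
          refine measure_mono fun S hS => ?_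
          simpa using hS
      _ ≤ ∑ i, Measure.pi (fun _ : Fin m => (p : Measure X)) {S | ¬ G i p (D i S)} :=
          measure_iUnion_fintype_le _ _
      _ ≤ ∑ _i : ι, ENNReal.ofReal δ := Finset.sum_le_sum fun i _ => hp i p
      _ = ENNReal.ofReal (Fintype.card ι * δ) := by
          rw [Finset.sum_const, nsmul_eq_mul, ENNReal.ofReal_mul (by positivity),
            ENNReal.ofReal_natCast, Finset.card_univ]

end Learnable

end Learnable

section Hoeffding

variable {X : Type*} [MeasurableSpace X]

lemma hoeffding_sum_ge (p : ProbabilityMeasure X) {f : X → ℝ} (hf : Measurable f) {a : ℝ}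
    (hb : ∀ x, f x ∈ Set.Icc a (a + 1)) (m : ℕ) {τ : ℝ} (hτ : 0 ≤ τ) :
    Measure.pi (fun _ : Fin m => (p : Measure X))
      {S | m * τ ≤ ∑ t, (f (S t) - ∫ x, f x ∂(p : Measure X))} ≤
        ENNReal.ofReal (Real.exp (-(2 * m * τ ^ 2))) := by
  set μ := Measure.pi (fun _ : Fin m => (p : Measure X))
  set e : ℝ := ∫ x, f x ∂(p : Measure X) with he
  have hind : ProbabilityTheory.iIndepFun (fun (t : Fin m) (S : Fin m → X) => f (S t) - e) μ :=
    ProbabilityTheory.iIndepFun_pi (X := fun _ x => f x - e)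
      fun _ => (hf.sub_const e).aemeasurable
  have hsub : ∀ t ∈ (Finset.univ : Finset (Fin m)),
      ProbabilityTheory.HasSubgaussianMGF (fun S : Fin m → X => f (S t) - e)
        ((‖(a + 1) - a‖₊ / 2) ^ 2) μ := by
    intro t _
    have hmp := measurePreserving_eval (fun _ : Fin m => (p : Measure X)) t
    have hint : ∫ S, f (S t) ∂μ = e := by
      rw [he, ← hmp.map_eq, integral_map hmp.measurable.aemeasurable
        hf.aestronglyMeasurable]
    have h := ProbabilityTheory.hasSubgaussianMGF_of_mem_Icc (μ := μ)
      (X := fun S : Fin m → X => f (S t)) (a := a) (b := a + 1)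
      (hf.comp (measurable_pi_apply t)).aemeasurable (.of_forall fun S => hb _)
    rwa [hint] at h
  have h := ProbabilityTheory.HasSubgaussianMGF.measure_sum_ge_le_of_iIndepFun hind hsub
    (ε := m * τ) (by positivity)
  rw [← ofReal_measureReal]
  refine ENNReal.ofReal_le_ofReal (h.trans (Real.exp_le_exp.2 (le_of_eq ?_)))
  have hn : ‖(a + 1) - a‖₊ = 1 := by simp
  rw [hn]
  simp only [Finset.sum_const, Finset.card_univ, Fintype.card_fin, nsmul_eq_mul]
  push_cast
  rcases eq_or_ne m 0 with rfl | hm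
  · simp
  · have : (m : ℝ) ≠ 0 := by exact_mod_cast hm
    field_simp

/-- Thresholding an empirical mean decides on which side of `c` the true mean lies, with
tolerance `τ`. -/
lemma Learnable.threshold (F : RandTest X) (c : ℝ) {τ δ : ℝ} (hτ : 0 ≤ τ) {m : ℕ}
    (hδ : Real.exp (-(2 * m * τ ^ 2)) ≤ δ) :
    Learnable m δ fun (p : ProbabilityMeasure X) (b : Prop) =>
      (b → c - τ ≤ ∫ x, F.toFun x ∂(p : Measure X)) ∧
        (¬ b → ∫ x, F.toFun x ∂(p : Measure X) < c + τ) := by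
  have hFt : ∀ t : Fin m, Measurable fun S : Fin m → X => F.toFun (S t) :=
    fun t => F.measurable_toFun.comp (measurable_pi_apply t)
  refine ⟨fun S => m * c ≤ ∑ t, F.toFun (S t), Set.toFinite _, fun s => ?_, fun p => ?_⟩
  · have : Measurable fun S : Fin m → X => (m * c ≤ ∑ t, F.toFun (S t) : Prop) :=
      measurableSet_setOfPred.1
        (measurableSet_le measurable_const (Finset.measurable_sum _ fun t _ => hFt t))
    exact this trivial
  set e : ℝ := ∫ x, F.toFun x ∂(p : Measure X) with he
  refine le_trans ?_ (ENNReal.ofReal_le_ofReal hδ)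
  rcases lt_or_ge e (c - τ) with h1 | h1
  · refine (measure_mono fun S hS => ?_).trans
      (hoeffding_sum_ge p F.measurable_toFun (a := 0) (by simpa using F.mem_Icc) m hτ)
    have hS' : m * c ≤ ∑ t, F.toFun (S t) := by
      by_contra hcon
      exact hS ⟨fun h => absurd h hcon, fun _ => by linarith⟩
    change m * τ ≤ ∑ t, (F.toFun (S t) - e)
    rw [Finset.sum_sub_distrib]
    simp only [Finset.sum_const, Finset.card_univ, Fintype.card_fin, nsmul_eq_mul]
    nlinarith [(Nat.cast_nonneg m : (0 : ℝ) ≤ m)]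
  · refine (measure_mono fun S hS => ?_).trans
      (hoeffding_sum_ge p (f := fun x => -F.toFun x) F.measurable_toFun.neg (a := -1)
        (fun x => ⟨by linarith [(F.mem_Icc x).2], by linarith [(F.mem_Icc x).1]⟩) m hτ)
    have hS' : ¬ (m * c ≤ ∑ t, F.toFun (S t)) ∧ c + τ ≤ e := by
      by_contra hcon
      refine hS ⟨fun _ => h1, fun h => ?_⟩
      by_contra h2
      exact hcon ⟨h, not_lt.1 h2⟩
    change m * τ ≤ ∑ t, (-F.toFun (S t) - ∫ x, -F.toFun x ∂(p : Measure X))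
    rw [Finset.sum_sub_distrib, integral_neg, Finset.sum_neg_distrib]
    simp only [Finset.sum_const, Finset.card_univ, Fintype.card_fin, nsmul_eq_mul]
    nlinarith [(Nat.cast_nonneg m : (0 : ℝ) ≤ m), hS'.1, hS'.2]

end Hoeffding

section Minimax

/-- A finite minimax alternative: either some convex combination of randomized tests beats the
thresholds `θ` on every cell, or some distribution on the cells meets all thresholds. -/
lemma finite_minimax {ι κ : Type*} [Fintype ι] [Nonempty ι] [Fintype κ]
    (Q : ι → κ → ℝ) (θ : ι → ℝ) :
    (∃ (h : ι → ℝ) (u : ι → κ → ℝ), (∀ i c, 0 ≤ u i c ∧ u i c ≤ h i) ∧ (∀ i, 0 ≤ h i) ∧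
      ∀ c, 0 < ∑ i, (u i c - ∑ c', u i c' * Q i c' - h i * θ i)) ∨
    ∃ π : κ → ℝ, (∀ c, 0 ≤ π c) ∧ ∑ c, π c = 1 ∧
      ∀ i (g : κ → ℝ), (∀ c, 0 ≤ g c ∧ g c ≤ 1) → ∑ c, (π c - Q i c) * g c ≤ θ i := by
  classical
  let s : Set (κ → ℝ) := {v | ∀ c, 0 < v c}
  let t : Set (κ → ℝ) := {v | ∃ (h : ι → ℝ) (u : ι → κ → ℝ),
    (∀ i c, 0 ≤ u i c ∧ u i c ≤ h i) ∧ (∀ i, 0 ≤ h i) ∧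
      ∀ c, v c = ∑ i, (u i c - ∑ c', u i c' * Q i c' - h i * θ i)}
  by_cases hdisj : Disjoint s t
  swap
  · left
    obtain ⟨v, hv, h, u, h1, h2, h3⟩ := Set.not_disjoint_iff.1 hdisj
    exact ⟨h, u, h1, h2, fun c => h3 c ▸ hv c⟩
  right
  have hs : Convex ℝ s := by
    intro x hx y hy a b ha hb hab c
    have hxc := hx c
    have hyc := hy c
    simp only [Pi.add_apply, Pi.smul_apply, smul_eq_mul]
    rcases ha.eq_or_lt with rfl | ha'
    · have : b = 1 := by linarith
      subst this
      linarith
    · nlinarith [mul_pos ha' hxc, mul_nonneg hb hyc.le]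
  have hso : IsOpen s := by
    have : s = ⋂ c, {v : κ → ℝ | 0 < v c} := by
      ext v
      simp [s]
    rw [this]
    exact isOpen_iInter_of_finite fun c => isOpen_lt continuous_const (continuous_apply c)
  have ht : Convex ℝ t := by
    rintro x ⟨h, u, h1, h2, h3⟩ y ⟨h', u', h1', h2', h3'⟩ a b ha hb hab
    refine ⟨fun i => a * h i + b * h' i, fun i c => a * u i c + b * u' i c, fun i c => ⟨?_, ?_⟩,
      fun i => ?_, fun c => ?_⟩
    · exact add_nonneg (mul_nonneg ha (h1 i c).1) (mul_nonneg hb (h1' i c).1)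
    · exact add_le_add (mul_le_mul_of_nonneg_left (h1 i c).2 ha)
        (mul_le_mul_of_nonneg_left (h1' i c).2 hb)
    · exact add_nonneg (mul_nonneg ha (h2 i)) (mul_nonneg hb (h2' i))
    · simp only [Pi.add_apply, Pi.smul_apply, smul_eq_mul, h3 c, h3' c]
      rw [Finset.mul_sum, Finset.mul_sum, ← Finset.sum_add_distrib]
      refine Finset.sum_congr rfl fun i _ => ?_
      have : ∑ c', (a * u i c' + b * u' i c') * Q i c' =
          a * ∑ c', u i c' * Q i c' + b * ∑ c', u' i c' * Q i c' := by
        rw [Finset.mul_sum, Finset.mul_sum, ← Finset.sum_add_distrib]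
        exact Finset.sum_congr rfl fun c' _ => by ring
      rw [this]
      ring
  obtain ⟨f, r, hfs, hft⟩ := geometric_hahn_banach_open hs hso ht hdisj
  have hone : ∀ a : ℝ, 0 < a → a * f 1 < r := by
    intro a ha
    have := hfs (a • 1) fun c => by simpa using ha
    simpa using this
  have hr : 0 ≤ r := by
    by_contra hr
    push Not at hr
    have hpos : 0 < |f 1| + 1 := by positivity
    have h1 := hone (-r / (|f 1| + 1)) (div_pos (by linarith) hpos)
    rw [div_mul_eq_mul_div, div_lt_iff₀ hpos] at h1
    nlinarith [neg_abs_le (f 1)]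
  set e : κ → ℝ := fun c => f (Pi.single c 1) with he
  have hf : ∀ v : κ → ℝ, f v = ∑ c, v c * e c := by
    intro v
    conv_lhs => rw [← Finset.univ_sum_single v, map_sum]
    refine Finset.sum_congr rfl fun c _ => ?_
    rw [he, ← smul_eq_mul, ← map_smul, ← Pi.single_smul, smul_eq_mul, mul_one]
  have hneg : ∀ c, e c ≤ 0 := by
    intro c
    by_contra hc
    push Not at hc
    have hT : 0 ≤ |r - f 1| / e c := by positivity
    have h1 := hfs (1 + (|r - f 1| / e c) • Pi.single c 1) fun c' => by
      have : 0 ≤ (Pi.single c 1 : κ → ℝ) c' := by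
        rw [Pi.single_apply]; split_ifs <;> norm_num
      simp only [Pi.add_apply, Pi.one_apply, Pi.smul_apply, smul_eq_mul]
      nlinarith [mul_nonneg hT this]
    rw [map_add, map_smul, smul_eq_mul] at h1
    change f 1 + |r - f 1| / e c * e c < r at h1
    rw [div_mul_cancel₀ _ hc.ne'] at h1
    linarith [le_abs_self (r - f 1)]
  have hmem : ∀ i (g : κ → ℝ), (∀ c, 0 ≤ g c ∧ g c ≤ 1) →
      (fun c => g c - ∑ c', g c' * Q i c' - θ i) ∈ t := by
    intro i g hg
    refine ⟨Pi.single i 1, Pi.single i g, fun j c => ?_, fun j => ?_, fun c => ?_⟩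
    · rcases eq_or_ne j i with rfl | hj
      · simpa using hg c
      · simp [Pi.single_eq_of_ne hj]
    · rw [Pi.single_apply]; split_ifs <;> norm_num
    · rw [Finset.sum_eq_single i]
      · simp
      · intro j _ hj
        simp [Pi.single_eq_of_ne hj]
      · simp
  have hZ : 0 < ∑ c, -e c := by
    refine (Finset.sum_nonneg fun c _ => neg_nonneg.2 (hneg c)).lt_of_ne' fun h0 => ?_
    rw [Finset.sum_eq_zero_iff_of_nonneg fun c _ => neg_nonneg.2 (hneg c)] at h0
    have hzero : ∀ v, f v = 0 := fun v => by
      rw [hf]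
      exact Finset.sum_eq_zero fun c hc => by rw [neg_eq_zero.1 (h0 c hc), mul_zero]
    obtain ⟨i⟩ := ‹Nonempty ι›
    have h1 := hft _ (hmem i 0 fun c => by simp)
    have h2 := hone 1 one_pos
    rw [hzero] at h1 h2
    linarith
  set Z := ∑ c, -e c with hZdef
  have hsum : ∑ c, -e c / Z = 1 := by rw [← Finset.sum_div, ← hZdef, div_self hZ.ne']
  refine ⟨fun c => -e c / Z, fun c => div_nonneg (neg_nonneg.2 (hneg c)) hZ.le, hsum,
    fun i g hg => ?_⟩
  have h1 := hr.trans (hft _ (hmem i g hg))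
  rw [hf] at h1
  set B := ∑ c', g c' * Q i c'
  have h2 : ∑ c, (g c - B - θ i) * e c = ∑ c, g c * e c + (B + θ i) * Z := by
    rw [hZdef, Finset.mul_sum, ← Finset.sum_add_distrib]
    exact Finset.sum_congr rfl fun c _ => by ring
  have h3 : ∑ c, (-e c / Z - Q i c) * g c = -(∑ c, g c * e c) / Z - B := by
    rw [← Finset.sum_neg_distrib, Finset.sum_div, ← Finset.sum_sub_distrib]
    exact Finset.sum_congr rfl fun c _ => by ring
  rw [h3, sub_le_iff_le_add, div_le_iff₀ hZ]
  linarith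

variable {X : Type*} [MeasurableSpace X]

lemma sum_measureReal_inter_fiber {κ : Type*} [Fintype κ] (μ : Measure X) [IsFiniteMeasure μ]
    (c : X → κ) (hc : ∀ k, MeasurableSet (c ⁻¹' {k})) (A : Set X) :
    ∑ k, μ.real (A ∩ c ⁻¹' {k}) = μ.real A := by
  have h := sum_measureReal_preimage_singleton (μ := μ.restrict A) Finset.univ (f := c)
    (fun k _ => hc k)
  simp only [Finset.coe_univ, Set.preimage_univ] at h
  rw [measureReal_restrict_apply_univ] at h
  rw [← h]
  refine Finset.sum_congr rfl fun k _ => ?_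
  rw [measureReal_restrict_apply (hc k), Set.inter_comm]

/-- Finitely many probability measures are, up to `ε` in total variation, recovered by a fixed
Markov kernel from their restrictions to a finite partition. -/
lemma exists_discretization {ι : Type} [Fintype ι] [Nonempty ι] (q : ι → ProbabilityMeasure X)
    {ε : ℝ} (hε : 0 < ε) :
    ∃ (κ : Type) (_ : Fintype κ) (c : X → κ) (ν : κ → ProbabilityMeasure X),
      (∀ k, MeasurableSet (c ⁻¹' {k})) ∧ ∀ i A, MeasurableSet A →
        ∑ k, (q i : Measure X).real (c ⁻¹' {k}) * (ν k : Measure X).real A -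
          (q i : Measure X).real A ≤ ε := by
  classical
  set μ : Measure X := ∑ i, (q i : Measure X) with hμ
  have hle : ∀ i, (q i : Measure X) ≤ μ := fun i =>
    Finset.single_le_sum (f := fun i => (q i : Measure X)) (fun _ _ => Measure.zero_le _)
      (Finset.mem_univ i)
  have hac : ∀ i, (q i : Measure X) ≪ μ := fun i => Measure.absolutelyContinuous_of_le (hle i)
  obtain ⟨N, hN⟩ := exists_nat_gt (μ.real Set.univ / ε)
  have hN0 : (0 : ℝ) < N := lt_of_le_of_lt (by positivity) hN
  let f : ι → X → ℝ := fun i x => ((q i : Measure X).rnDeriv μ x).toReal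
  have hfm : ∀ i, Measurable (f i) := fun i => (Measure.measurable_rnDeriv _ _).ennreal_toReal
  have hf0 : ∀ i x, 0 ≤ f i x := fun i x => ENNReal.toReal_nonneg
  have hf1 : ∀ i, ∀ᵐ x ∂μ, f i x ≤ 1 := by
    intro i
    filter_upwards [Measure.rnDeriv_le_one_of_le (hle i)] with x hx
    exact ENNReal.toReal_le_of_le_ofReal zero_le_one (by simpa using hx)
  let c : X → (ι → Fin (N + 1)) := fun x i =>
    ⟨min N ⌊N * f i x⌋₊, Nat.lt_succ_of_le (min_le_left _ _)⟩
  have hcm : ∀ k, MeasurableSet (c ⁻¹' {k}) := by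
    intro k
    have : c ⁻¹' {k} = ⋂ i, (fun x => ⌊N * f i x⌋₊) ⁻¹' {j | min N j = k i} := by
      ext x
      simp [c, funext_iff, Fin.ext_iff]
    rw [this]
    exact MeasurableSet.iInter fun i =>
      (Nat.measurable_floor.comp ((hfm i).const_mul _)) (MeasurableSet.of_discrete)
  have hreal : ∀ i (B : Set X), (q i : Measure X).real B = ∫ x in B, f i x ∂μ := fun i B =>
    (Measure.setIntegral_toReal_rnDeriv (hac i) B).symm
  have hfi : ∀ i, Integrable (f i) μ := fun i => Measure.integrable_toReal_rnDeriv
  have hcell : ∀ i k, ∀ᵐ x ∂μ, x ∈ c ⁻¹' {k} →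
      (k i : ℝ) / N ≤ f i x ∧ f i x ≤ ((k i : ℝ) + 1) / N := by
    intro i k
    filter_upwards [hf1 i] with x hx hxk
    have hk : ((k i : ℕ)) = ⌊N * f i x⌋₊ := by
      rw [← show c x = k from hxk]
      refine min_eq_right (Nat.floor_le_of_le ?_)
      nlinarith
    rw [hk, div_le_iff₀ hN0, le_div_iff₀ hN0, mul_comm (f i x)]
    exact ⟨Nat.floor_le (mul_nonneg hN0.le (hf0 i x)), (Nat.lt_floor_add_one _).le⟩
  have hlow : ∀ i k (B : Set X), MeasurableSet B → B ⊆ c ⁻¹' {k} →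
      (k i : ℝ) / N * μ.real B ≤ (q i : Measure X).real B := by
    intro i k B hB hBk
    have h := setIntegral_mono_on_ae (μ := μ) (s := B) (f := fun _ => (k i : ℝ) / N) (g := f i)
      (integrable_const _).integrableOn (hfi i).integrableOn hB
      ((hcell i k).mono fun x hx hxB => (hx (hBk hxB)).1)
    rw [setIntegral_const, smul_eq_mul, mul_comm, ← hreal] at h
    exact h
  have hupp : ∀ i k (B : Set X), MeasurableSet B → B ⊆ c ⁻¹' {k} →
      (q i : Measure X).real B ≤ ((k i : ℝ) + 1) / N * μ.real B := by
    intro i k B hB hBk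
    have h := setIntegral_mono_on_ae (μ := μ) (s := B) (f := f i)
      (g := fun _ => ((k i : ℝ) + 1) / N)
      (hfi i).integrableOn (integrable_const _).integrableOn hB
      ((hcell i k).mono fun x hx hxB => (hx (hBk hxB)).2)
    rw [setIntegral_const, smul_eq_mul, ← hreal] at h
    rwa [mul_comm] at h
  obtain ⟨i₀⟩ := ‹Nonempty ι›
  let ν : (ι → Fin (N + 1)) → ProbabilityMeasure X := fun k =>
    if h : μ (c ⁻¹' {k}) = 0 then q i₀ else
      ⟨ProbabilityTheory.cond μ (c ⁻¹' {k}), ProbabilityTheory.cond_isProbabilityMeasure h⟩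
  refine ⟨ι → Fin (N + 1), inferInstance, c, ν, hcm, fun i A hA => ?_⟩
  have hterm : ∀ k, (q i : Measure X).real (c ⁻¹' {k}) * (ν k : Measure X).real A -
      (q i : Measure X).real (A ∩ c ⁻¹' {k}) ≤ μ.real (A ∩ c ⁻¹' {k}) / N := by
    intro k
    by_cases h : μ (c ⁻¹' {k}) = 0
    · have h0 : (q i : Measure X).real (c ⁻¹' {k}) = 0 := by
        rw [measureReal_def, hac i h, ENNReal.toReal_zero]
      rw [h0, zero_mul, zero_sub]
      exact (neg_nonpos.2 measureReal_nonneg).trans (by positivity)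
    · have hν : (ν k : Measure X).real A = μ.real (A ∩ c ⁻¹' {k}) / μ.real (c ⁻¹' {k}) := by
        have : (ν k : Measure X) = ProbabilityTheory.cond μ (c ⁻¹' {k}) := by
          rw [show ν k = ⟨_, ProbabilityTheory.cond_isProbabilityMeasure h⟩ from dif_neg h]
          rfl
        rw [this, measureReal_def, ProbabilityTheory.cond_apply (hcm k), ENNReal.toReal_mul,
          ENNReal.toReal_inv, Set.inter_comm, mul_comm, ← div_eq_mul_inv]
        rfl
      have hpos : 0 < μ.real (c ⁻¹' {k}) :=
        ENNReal.toReal_pos h (measure_ne_top _ _)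
      have h1 := hlow i k (A ∩ c ⁻¹' {k}) (hA.inter (hcm k)) Set.inter_subset_right
      have h2 := hupp i k (c ⁻¹' {k}) (hcm k) subset_rfl
      have h3 : (q i : Measure X).real (c ⁻¹' {k}) * (ν k : Measure X).real A ≤
          ((k i : ℝ) + 1) / N * μ.real (A ∩ c ⁻¹' {k}) := by
        rw [hν, mul_div_assoc', div_le_iff₀ hpos]
        nlinarith [mul_le_mul_of_nonneg_right h2
          (measureReal_nonneg (μ := μ) (s := A ∩ c ⁻¹' {k}))]
      have h4 : ((k i : ℝ) + 1) / N * μ.real (A ∩ c ⁻¹' {k}) =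
        (k i : ℝ) / N * μ.real (A ∩ c ⁻¹' {k}) + μ.real (A ∩ c ⁻¹' {k}) / N := by ring
      linarith
  have hsum := Finset.sum_le_sum fun k (_ : k ∈ Finset.univ) => hterm k
  rw [Finset.sum_sub_distrib, sum_measureReal_inter_fiber _ c hcm, ← Finset.sum_div,
    sum_measureReal_inter_fiber _ c hcm] at hsum
  refine hsum.trans ?_
  rw [div_le_iff₀ hN0]
  rw [div_lt_iff₀ hε] at hN
  have : μ.real A ≤ μ.real Set.univ := measureReal_mono (Set.subset_univ _)
  linarith

/-- Either some probability measure is within `θ i + ε` of every `q i`, or there are tests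
certifying that each probability measure is farther than `θ i` from some `q i`. -/
lemma exists_measure_or_tests {ι : Type} [Fintype ι] [Nonempty ι] (q : ι → ProbabilityMeasure X)
    (θ : ι → ℝ) {ε : ℝ} (hε : 0 < ε) :
    (∃ P : ProbabilityMeasure X, ∀ i, tv (P : Measure X) (q i) ≤ θ i + ε) ∨
    ∃ F : ι → RandTest X, ∀ p : ProbabilityMeasure X,
      ∃ i, θ i < (F i).adv (p : Measure X) (q i) := by
  obtain ⟨κ, _, c, ν, hc, hν⟩ := exists_discretization q hε
  rcases finite_minimax (fun i k => (q i : Measure X).real (c ⁻¹' {k})) θ with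
    ⟨h, u, hu, hh, hpos⟩ | ⟨π, hπ, hπ1, hg⟩
  · right
    have hmeas : ∀ g : κ → ℝ, Measurable fun x => g (c x) := by
      intro g
      let : MeasurableSpace κ := ⊤
      have hcm : Measurable c := measurable_to_countable' hc
      exact (measurable_from_top (f := g)).comp hcm
    have hint : ∀ (p : ProbabilityMeasure X) (g : κ → ℝ),
        ∫ x, g (c x) ∂(p : Measure X) = ∑ k, g k * (p : Measure X).real (c ⁻¹' {k}) := by
      intro p g
      let : MeasurableSpace κ := ⊤
      have hcm : Measurable c := measurable_to_countable' hc
      have : IsProbabilityMeasure ((p : Measure X).map c) :=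
        Measure.isProbabilityMeasure_map hcm.aemeasurable
      rw [← integral_map hcm.aemeasurable (f := g)
        (measurable_from_top (f := g)).aestronglyMeasurable, integral_fintype .of_finite]
      refine Finset.sum_congr rfl fun k _ => ?_
      rw [map_measureReal_apply hcm (MeasurableSpace.measurableSet_top), smul_eq_mul, mul_comm]
    let F : ι → RandTest X := fun i =>
      { toFun := fun x => u i (c x) / h i
        measurable_toFun := hmeas fun k => u i k / h i
        mem_Icc := fun x => ⟨div_nonneg (hu i _).1 (hh i), div_le_one_of_le₀ (hu i _).2 (hh i)⟩ }
    refine ⟨F, fun p => ?_⟩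
    have hmul : ∀ i (p : ProbabilityMeasure X), h i * ∫ x, (F i).toFun x ∂(p : Measure X) =
        ∑ k, u i k * (p : Measure X).real (c ⁻¹' {k}) := by
      intro i p
      rw [← integral_const_mul, ← hint p (u i)]
      refine integral_congr_ae (.of_forall fun x => ?_)
      change h i * (u i (c x) / h i) = u i (c x)
      rcases (hh i).eq_or_lt with h0 | h0
      · have := hu i (c x)
        rw [← h0] at this ⊢
        linarith [this.1, this.2]
      · field_simp
    have hps : ∑ k, (p : Measure X).real (c ⁻¹' {k}) = 1 := by
      have := sum_measureReal_inter_fiber (p : Measure X) c hc Set.univ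
      simpa using this
    have htot : 0 < ∑ i, h i * ((F i).adv (p : Measure X) (q i) - θ i) := by
      have h1 : ∀ i, h i * ((F i).adv (p : Measure X) (q i) - θ i) =
          ∑ k, (p : Measure X).real (c ⁻¹' {k}) *
            (u i k - ∑ k', u i k' * (q i : Measure X).real (c ⁻¹' {k'}) - h i * θ i) := by
        intro i
        rw [RandTest.adv, mul_sub, mul_sub, hmul i p, hmul i (q i)]
        simp only [mul_sub, Finset.sum_sub_distrib, ← Finset.sum_mul, hps, one_mul]
        simp only [mul_comm]
      simp only [h1]
      rw [Finset.sum_comm]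
      simp only [← Finset.mul_sum]
      have hnn : ∀ k ∈ Finset.univ, 0 ≤ (p : Measure X).real (c ⁻¹' {k}) *
          ∑ i, (u i k - ∑ k', u i k' * (q i : Measure X).real (c ⁻¹' {k'}) - h i * θ i) :=
        fun k _ => mul_nonneg measureReal_nonneg (hpos k).le
      refine (Finset.sum_nonneg hnn).lt_of_ne' fun h0 => ?_
      rw [Finset.sum_eq_zero_iff_of_nonneg hnn] at h0
      have : ∑ k, (p : Measure X).real (c ⁻¹' {k}) = 0 := Finset.sum_eq_zero fun k hk =>
        (mul_eq_zero.1 (h0 k hk)).resolve_right (hpos k).ne'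
      linarith
    obtain ⟨i, -, hi⟩ := Finset.exists_lt_of_sum_lt (s := Finset.univ) (f := fun _ : ι => (0 : ℝ))
      (by simpa using htot)
    exact ⟨i, sub_pos.1 (pos_of_mul_pos_right hi (hh i))⟩
  · left
    obtain ⟨P, hP⟩ := exists_mixture π hπ hπ1 ν
    refine ⟨P, fun i => tv_le_of_forall_sub_le fun A hA => ?_⟩
    have h1 := hν i A hA
    have h2 := hg i (fun k => (ν k : Measure X).real A)
      fun k => ⟨measureReal_nonneg, measureReal_le_one⟩
    simp only [sub_mul, Finset.sum_sub_distrib] at h2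
    rw [hP]
    linarith

end Minimax

section LevelLearner

lemma exists_closed_subset {ι : Type*} [Fintype ι] (U : Finset ι) (β : Finset ι → ι → Prop) :
    ∃ S ⊆ U, (∀ i ∈ U, i ∉ S → ¬ β S i) ∧ ∀ i ∈ S, ∃ T, β T i := by
  classical
  let 𝒮 : Finset (Finset ι) := {S | S ⊆ U ∧ ∀ i ∈ S, ∃ T, β T i}
  obtain ⟨S, hS, hmax⟩ := 𝒮.exists_max_image Finset.card ⟨∅, by simp [𝒮]⟩
  obtain ⟨hSU, hSβ⟩ : S ⊆ U ∧ ∀ i ∈ S, ∃ T, β T i := by simpa [𝒮] using hS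
  refine ⟨S, hSU, fun i hiU hiS hβ => ?_, hSβ⟩
  have h := hmax (insert i S) <| by
    simp only [𝒮, Finset.mem_filter, Finset.mem_univ, true_and, Finset.mem_insert]
    refine ⟨Finset.insert_subset hiU hSU, ?_⟩
    rintro j (rfl | hj)
    exacts [⟨S, hβ⟩, hSβ j hj]
  rw [Finset.card_insert_of_notMem hiS] at h
  omega

variable {X : Type*} [MeasurableSpace X] {ι : Type}

/-- Specification of one level of the learner. Provided `p` is at excess distance at least `w`
from every `q i` with `i ∈ U`, the output is either a measure whose excess distances are at most
`θ` off `U` and within a factor `4` of those of `p` on `U`, or a family of tests one of which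
certifies, off `U`, an excess distance at least `θ i - s` for `p`. -/
def LevelSpec (q : ι → ProbabilityMeasure X) (ℓ : ι → ℝ) (s : ℝ) (U : Finset ι) (θ : ι → ℝ)
    (w : ℝ) (p : ProbabilityMeasure X) (o : ProbabilityMeasure X ⊕ (ι → RandTest X)) : Prop :=
  (∀ i ∈ U, w ≤ tv (p : Measure X) (q i) - ℓ i) →
    (∀ P, o = .inl P → (∀ i ∉ U, tv (P : Measure X) (q i) - ℓ i ≤ θ i) ∧
      ∀ i ∈ U, tv (P : Measure X) (q i) - ℓ i ≤ 4 * (tv (p : Measure X) (q i) - ℓ i)) ∧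
    ∀ F, o = .inr F → ∃ i ∉ U, θ i - s ≤ (F i).adv (p : Measure X) (q i) - ℓ i

variable {q : ι → ProbabilityMeasure X} {ℓ : ι → ℝ} {s : ℝ}

lemma learnable_tests {w δ : ℝ} (hw : 0 ≤ w) (o : ProbabilityMeasure X ⊕ (ι → RandTest X))
    (i : ι) {m : ℕ} (hm : Real.exp (-(2 * m * (w / 2) ^ 2)) ≤ δ) :
    Learnable m δ fun (p : ProbabilityMeasure X) (b : Prop) => ∀ F, o = .inr F →
      (b → 2 * w ≤ (F i).adv (p : Measure X) (q i) - ℓ i) ∧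
        (¬ b → (F i).adv (p : Measure X) (q i) - ℓ i < 3 * w) := by
  rcases o with P | F
  · exact Learnable.pure True fun p F hF => by simp at hF
  · refine (Learnable.threshold (F i) (∫ x, (F i).toFun x ∂(q i : Measure X) + ℓ i + 5 / 2 * w)
      (div_nonneg hw zero_le_two) hm).map id ?_
    rintro p b ⟨h1, h2⟩ _ ⟨⟩
    simp only [RandTest.adv, id]
    exact ⟨fun hb => by linarith [h1 hb], fun hb => by linarith [h2 hb]⟩

variable [Fintype ι]

lemma exists_levelSpec_of_tests [DecidableEq ι] {w : ℝ} (hsw : s ≤ w) (U : Finset ι) (θ : ι → ℝ)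
    (o : Finset ι → ProbabilityMeasure X ⊕ (ι → RandTest X)) (b : Finset ι × ι → Prop) :
    ∃ o', ∀ p : ProbabilityMeasure X,
      (∀ z : Finset ι × ι, ∀ F, o z.1 = .inr F →
        (b z → 2 * w ≤ (F z.2).adv (p : Measure X) (q z.2) - ℓ z.2) ∧
          (¬ b z → (F z.2).adv (p : Measure X) (q z.2) - ℓ z.2 < 3 * w)) →
      (∀ V, LevelSpec q ℓ s V (fun i => if i ∈ U then 4 * w else θ i) (2 * w) p (o V)) →
      LevelSpec q ℓ s U θ w p o' := by
  obtain ⟨S, hSU, hS, hSβ⟩ := exists_closed_subset U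
    fun S i => (∃ F, o S = .inr F) ∧ b (S, i)
  refine ⟨o S, fun p hb hV hp => ?_⟩
  obtain ⟨h1, h2⟩ := hV S fun i hi => by
    obtain ⟨T, ⟨F, hF⟩, hT⟩ := hSβ i hi
    linarith [(hb (T, i) F hF).1 hT, (F i).adv_le_tv (p : Measure X) (q i)]
  refine ⟨fun P hP => ⟨fun i hi => ?_, fun i hi => ?_⟩, fun F hF => ?_⟩
  · simpa [hi] using (h1 P hP).1 i fun hiS => hi (hSU hiS)
  · by_cases hiS : i ∈ S
    · exact (h1 P hP).2 i hiS
    · have h := (h1 P hP).1 i hiS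
      simp only [if_pos hi] at h
      linarith [hp i hi]
  · obtain ⟨i, hiS, hi⟩ := h2 F hF
    by_cases hiU : i ∈ U
    · simp only [if_pos hiU] at hi
      have hnb : ¬ b (S, i) := fun h => hS i hiU hiS ⟨⟨F, hF⟩, h⟩
      linarith [(hb (S, i) F hF).2 hnb]
    · simp only [if_neg hiU] at hi
      exact ⟨i, hiU, hi⟩

variable [Nonempty ι]

lemma learnable_levelSpec_of_four_lt (hℓ : ∀ i, -2 ≤ ℓ i) (hs : 0 < s) {w : ℝ} (hw : 4 < w)
    (U : Finset ι) (θ : ι → ℝ) (m : ℕ) (δ : ℝ) : Learnable m δ (LevelSpec q ℓ s U θ w) := by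
  have hU : ∀ p : ProbabilityMeasure X, (∀ i ∈ U, w ≤ tv (p : Measure X) (q i) - ℓ i) →
      ∀ i, i ∉ U := by
    intro p hp i hi
    linarith [hp i hi, tv_le_one (p : Measure X) (q i), hℓ i]
  rcases exists_measure_or_tests q (fun i => θ i + ℓ i - s) hs with ⟨P, hP⟩ | ⟨F, hF⟩
  · refine Learnable.pure (.inl P) fun p hp => ⟨?_, by simp⟩
    rintro _ ⟨⟩
    exact ⟨fun i _ => by linarith [hP i], fun i hi => absurd hi (hU p hp i)⟩
  · refine Learnable.pure (.inr F) fun p hp => ⟨by simp, ?_⟩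
    rintro _ ⟨⟩
    obtain ⟨i, hi⟩ := hF p
    exact ⟨i, hU p hp i, by linarith⟩

/-- Sample size bookkeeping for one recursion step of the level learner. -/
lemma exists_level_sample_split {n : ℕ} (hn : 1 ≤ n) {w δ : ℝ} (hw : 0 < w) (hw4 : w ≤ 4)
    (hδ : 0 < δ) (hδ1 : δ ≤ 1) {m : ℕ} (hm : 88 * (n + Real.log (1 / δ)) / w ^ 2 ≤ m) :
    ∃ m₁ m₂ : ℕ, m₁ + m₂ = m ∧
      88 * (n + Real.log (1 / (δ / 2 ^ (n + 1)))) / (2 * w) ^ 2 ≤ m₁ ∧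
      Real.exp (-(2 * m₂ * (w / 2) ^ 2)) ≤ δ / (2 * (2 ^ n * n)) := by
  have hn' : (1 : ℝ) ≤ n := by exact_mod_cast hn
  have hL : 0 ≤ Real.log (1 / δ) := Real.log_nonneg (by rw [le_div_iff₀ hδ]; linarith)
  set L := Real.log (1 / δ) with hLdef
  have hexpL : Real.exp (-L) = δ := by
    rw [hLdef, one_div, Real.log_inv, neg_neg, Real.exp_log hδ]
  have hlog : Real.log (1 / (δ / 2 ^ (n + 1))) ≤ (n + 1) + L := by
    rw [one_div_div, show (2 : ℝ) ^ (n + 1) / δ = 2 ^ (n + 1) * (1 / δ) by ring,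
      Real.log_mul (by positivity) (by positivity), Real.log_pow]
    push_cast
    nlinarith [Real.log_two_lt_d9]
  have hw2 : 0 < w ^ 2 := by positivity
  set x := 88 * (n + Real.log (1 / (δ / 2 ^ (n + 1)))) / (2 * w) ^ 2 with hx
  have hxw : x * w ^ 2 ≤ 66 * (n + L) := by
    have : x * w ^ 2 = 22 * (n + Real.log (1 / (δ / 2 ^ (n + 1)))) := by
      rw [hx]
      field_simp
      ring
    rw [this]
    linarith
  have hx0 : 0 ≤ x := by
    have : 0 ≤ Real.log (1 / (δ / 2 ^ (n + 1))) := by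
      refine Real.log_nonneg ?_
      rw [one_div_div, le_div_iff₀ hδ, one_mul]
      exact hδ1.trans (one_le_pow₀ one_le_two)
    positivity
  have hm' : 88 * (n + L) ≤ m * w ^ 2 := by rwa [div_le_iff₀ hw2] at hm
  have hceil : (⌈x⌉₊ : ℝ) < x + 1 := Nat.ceil_lt_add_one hx0
  have hrest : 6 * (n + L) ≤ (m - ⌈x⌉₊) * w ^ 2 := by nlinarith
  have hle : ⌈x⌉₊ ≤ m := by
    have : (0 : ℝ) < m - ⌈x⌉₊ := pos_of_mul_pos_left (by linarith) hw2.le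
    exact_mod_cast (by linarith : (⌈x⌉₊ : ℝ) ≤ m)
  refine ⟨⌈x⌉₊, m - ⌈x⌉₊, by omega, Nat.le_ceil x, ?_⟩
  rw [le_div_iff₀ (by positivity), Nat.cast_sub hle]
  have h2 : (2 : ℝ) ≤ Real.exp n := by linarith [Real.add_one_le_exp (n : ℝ)]
  have hpow : (2 : ℝ) ^ n ≤ Real.exp n := by
    rw [← Real.exp_one_pow]
    exact pow_le_pow_left₀ zero_le_two (by linarith [Real.add_one_le_exp (1 : ℝ)]) n
  have hnexp : (n : ℝ) ≤ Real.exp n := by linarith [Real.add_one_le_exp (n : ℝ)]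
  calc _ ≤ Real.exp (-(3 * n + L)) * (Real.exp n * (Real.exp n * Real.exp n)) := by
        gcongr
        nlinarith
    _ = Real.exp (-L) := by
        rw [← Real.exp_add, ← Real.exp_add, ← Real.exp_add]
        ring_nf
    _ = δ := hexpL

/-- Every level of the learner is implementable with `O((n + log (1 / δ)) / w ^ 2)` samples. -/
lemma learnable_levelSpec (hℓ : ∀ i, -2 ≤ ℓ i) (hs : 0 < s) (r : ℕ) :
    ∀ {w δ : ℝ}, s ≤ w → 4 < 2 ^ r * w → 0 < δ → δ ≤ 1 → ∀ (U : Finset ι) (θ : ι → ℝ) (m : ℕ),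
      88 * (Fintype.card ι + Real.log (1 / δ)) / w ^ 2 ≤ m →
        Learnable m δ (LevelSpec q ℓ s U θ w) := by
  classical
  induction r with
  | zero =>
    intro w δ _ hw _ _ U θ m _
    exact learnable_levelSpec_of_four_lt hℓ hs (by simpa using hw) U θ m δ
  | succ r ih =>
    intro w δ hsw hw hδ hδ1 U θ m hm
    rcases lt_or_ge 4 w with hw4 | hw4
    · exact learnable_levelSpec_of_four_lt hℓ hs hw4 U θ m δ
    have hw0 : 0 < w := hs.trans_le hsw
    have hn : 1 ≤ Fintype.card ι := Fintype.card_pos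
    obtain ⟨m₁, m₂, rfl, hm₁, hm₂⟩ := exists_level_sample_split hn hw0 hw4 hδ hδ1 hm
    have hδ' : δ / 2 ^ (Fintype.card ι + 1) ≤ 1 :=
      div_le_one_of_le₀ (hδ1.trans (one_le_pow₀ one_le_two)) (by positivity)
    have h₁ := Learnable.forall_fintype fun V : Finset ι =>
      ih (w := 2 * w) (by linarith) (by rw [pow_succ] at hw; linarith) (by positivity) hδ' V
        (fun i => if i ∈ U then 4 * w else θ i) m₁ hm₁
    have h₂ : ∀ o : Finset ι → ProbabilityMeasure X ⊕ (ι → RandTest X), Learnable m₂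
        (Fintype.card (Finset ι × ι) * (δ / (2 * (2 ^ Fintype.card ι * Fintype.card ι))))
        fun p o' => (∀ V, LevelSpec q ℓ s V (fun i => if i ∈ U then 4 * w else θ i) (2 * w) p
          (o V)) → LevelSpec q ℓ s U θ w p o' := by
      intro o
      choose f hf using exists_levelSpec_of_tests (q := q) (ℓ := ℓ) hsw U θ o
      exact (Learnable.forall_fintype fun z : Finset ι × ι =>
        learnable_tests (q := q) (ℓ := ℓ) hw0.le (o z.1) z.2 hm₂).map f fun p b => hf b p
    have h := h₁.bind (by positivity) (by positivity) h₂
    convert h using 1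
    have : (Fintype.card ι : ℝ) ≠ 0 := by positivity
    simp only [Fintype.card_finset, Fintype.card_prod]
    push_cast
    field_simp
    ring

end LevelLearner

section Improvement

variable {X : Type*} [MeasurableSpace X]

lemma exists_mixture_tv_le (P R : ProbabilityMeasure X) :
    ∃ M : ProbabilityMeasure X, ∀ ν : ProbabilityMeasure X, tv (M : Measure X) ν ≤
      3 / 4 * tv (P : Measure X) ν + 1 / 4 * tv (R : Measure X) ν := by
  obtain ⟨M, hM⟩ := exists_mixture (fun b : Bool => if b then (3 / 4 : ℝ) else 1 / 4)
    (fun b => by cases b <;> norm_num) (by norm_num) (fun b => if b then P else R)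
  refine ⟨M, fun ν => tv_le_of_forall_sub_le fun A hA => ?_⟩
  have h := hM A
  simp only [Fintype.sum_bool, if_true, Bool.false_eq_true, if_false] at h
  linarith [sub_le_tv (P : Measure X) ν hA, sub_le_tv (R : Measure X) ν hA]

variable {ι : Type} [Fintype ι] [Nonempty ι] {q : ι → ProbabilityMeasure X}

/-- A measure whose distances to all `q i` exceed those of `p` by at most `g` can be improved to
reduce the excess by a constant factor. -/
lemma learnable_improvement (P : ProbabilityMeasure X) {g δ : ℝ} (hg : 0 < g) (hg' : g ≤ 8 / 7)
    (hδ : 0 < δ) (hδ1 : δ ≤ 1) {m : ℕ}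
    (hm : 3168 * (Fintype.card ι + Real.log (1 / δ)) / g ^ 2 ≤ m) :
    Learnable m δ fun (p P' : ProbabilityMeasure X) =>
      (∀ i, tv (P : Measure X) (q i) ≤ tv (p : Measure X) (q i) + g) →
        ∀ i, tv (P' : Measure X) (q i) ≤ tv (p : Measure X) (q i) + 7 / 8 * g := by
  have hs : 0 < g / 6 := by positivity
  obtain ⟨r, hr⟩ := pow_unbounded_of_one_lt (4 / (g / 6)) one_lt_two
  have h := learnable_levelSpec (q := q) (ℓ := fun i => tv (P : Measure X) (q i) - g - g / 6)
    (fun i => by linarith [tv_nonneg (P : Measure X) (q i)]) hs r le_rfl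
    ((div_lt_iff₀ hs).1 hr) hδ hδ1 Finset.univ 0 m (le_of_eq_of_le (by ring) hm)
  choose M hM using exists_mixture_tv_le P
  refine h.map (Sum.elim M fun _ => P) fun p o ho hp i => ?_
  obtain ⟨h1, h2⟩ := ho fun i _ => by linarith [hp i]
  rcases o with R | F
  · have h3 := (h1 R rfl).2 i (Finset.mem_univ i)
    have h4 := hM R (q i)
    simp only [Sum.elim_inl]
    linarith
  · obtain ⟨j, hj, -⟩ := h2 F rfl
    exact absurd (Finset.mem_univ j) hj

/-- Sample size bookkeeping for one improvement step. -/
lemma exists_improvement_sample_split {n : ℕ} (hn : 1 ≤ n) {g δ : ℝ} (hg : 0 < g) (hg1 : g ≤ 1)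
    (hδ : 0 < δ) (hδ1 : δ ≤ 1) {m : ℕ} (hm : 170000 * (n + Real.log (1 / δ)) / g ^ 2 ≤ m) :
    ∃ m₁ m₂ : ℕ, m₁ + m₂ = m ∧
      170000 * (n + Real.log (1 / (9 / 10 * δ))) / (8 / 7 * g) ^ 2 ≤ m₁ ∧
      3168 * (n + Real.log (1 / (1 / 10 * δ))) / (8 / 7 * g) ^ 2 ≤ m₂ := by
  have hn' : (1 : ℝ) ≤ n := by exact_mod_cast hn
  have hlog : ∀ a : ℝ, 0 < a → a ≤ 1 → 0 ≤ Real.log (1 / (a * δ)) ∧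
      Real.log (1 / (a * δ)) ≤ 1 / a - 1 + Real.log (1 / δ) := by
    intro a ha ha1
    constructor
    · refine Real.log_nonneg ?_
      rw [le_div_iff₀ (by positivity)]
      nlinarith
    · rw [show 1 / (a * δ) = 1 / a * (1 / δ) by field_simp,
        Real.log_mul (by positivity) (by positivity)]
      linarith [Real.log_le_sub_one_of_pos (show 0 < 1 / a by positivity)]
  have hL : 0 ≤ Real.log (1 / δ) := by simpa using (hlog 1 one_pos le_rfl).1
  set L := Real.log (1 / δ)
  obtain ⟨h90, h9⟩ := hlog (9 / 10) (by norm_num) (by norm_num)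
  obtain ⟨-, h10⟩ := hlog (1 / 10) (by norm_num) (by norm_num)
  have hg2 : 0 < g ^ 2 := by positivity
  have hg2' : g ^ 2 ≤ 1 := by nlinarith
  set x := 170000 * (n + Real.log (1 / (9 / 10 * δ))) / (8 / 7 * g) ^ 2 with hx
  have hx0 : 0 ≤ x := by positivity
  have hxg : x * g ^ 2 = 170000 * (49 / 64) * (n + Real.log (1 / (9 / 10 * δ))) := by
    rw [hx]
    generalize Real.log (1 / (9 / 10 * δ)) = y
    field_simp
    ring
  have hm' : 170000 * (n + L) ≤ m * g ^ 2 := by rwa [div_le_iff₀ hg2] at hm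
  have hceil : (⌈x⌉₊ : ℝ) < x + 1 := Nat.ceil_lt_add_one hx0
  have hrest : 31680 * (n + L) * (49 / 64) ≤ (m - ⌈x⌉₊) * g ^ 2 := by
    nlinarith
  have hle : ⌈x⌉₊ ≤ m := by
    have : (0 : ℝ) < m - ⌈x⌉₊ := pos_of_mul_pos_left (by linarith) hg2.le
    exact_mod_cast (by linarith : (⌈x⌉₊ : ℝ) ≤ m)
  refine ⟨⌈x⌉₊, m - ⌈x⌉₊, by omega, Nat.le_ceil x, ?_⟩
  rw [Nat.cast_sub hle, div_le_iff₀ (by positivity)]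
  nlinarith

/-- Uniform estimation of the distances to the class: with `O((n + log (1 / δ)) / g ^ 2)` samples
one finds a measure whose distance to each `q i` exceeds that of `p` by at most `g`. -/
lemma learnable_tv_le_add (r : ℕ) : ∀ {g δ : ℝ}, (7 / 8) ^ r ≤ g → 0 < δ → δ ≤ 1 → ∀ m : ℕ,
    170000 * (Fintype.card ι + Real.log (1 / δ)) / g ^ 2 ≤ m →
      Learnable m δ fun (p P : ProbabilityMeasure X) =>
        ∀ i, tv (P : Measure X) (q i) ≤ tv (p : Measure X) (q i) + g := by
  have base : ∀ (m : ℕ) {g : ℝ} (δ : ℝ), 1 ≤ g → Learnable m δ fun (p P : ProbabilityMeasure X) =>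
      ∀ i, tv (P : Measure X) (q i) ≤ tv (p : Measure X) (q i) + g := by
    intro m g δ hg
    obtain ⟨i₀⟩ := ‹Nonempty ι›
    refine Learnable.pure (q i₀) fun p i => ?_
    linarith [tv_le_one (q i₀ : Measure X) (q i), tv_nonneg (p : Measure X) (q i)]
  induction r with
  | zero =>
    intro g δ hg _ _ m _
    exact base m δ (by simpa using hg)
  | succ r ih =>
    intro g δ hr hδ hδ1 m hm
    rcases le_or_gt 1 g with hg1 | hg1
    · exact base m δ hg1
    have hg : 0 < g := lt_of_lt_of_le (by positivity) hr
    obtain ⟨m₁, m₂, rfl, hm₁, hm₂⟩ :=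
      exists_improvement_sample_split Fintype.card_pos hg hg1.le hδ hδ1 hm
    have h₁ := ih (g := 8 / 7 * g) (by rw [pow_succ] at hr; linarith) (by positivity)
      (by linarith) m₁ hm₁
    have h₂ := fun P : ProbabilityMeasure X => learnable_improvement (q := q) P
      (g := 8 / 7 * g) (by positivity) (by linarith) (by positivity) (by linarith) hm₂
    have h := h₁.bind (by positivity) (by positivity) h₂
    rw [show 9 / 10 * δ + 1 / 10 * δ = δ by ring,
      show 7 / 8 * (8 / 7 * g) = g by ring] at h
    exact h

end Improvement

/-- **Explicit sample complexity for the improper upper bound.** There is a universal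
constant `C > 0` such that for every `d ≥ 1`, every finite class of `n` Borel probability
measures on `ℝ^d`, every `ε, δ ∈ (0,1)` and every `m ≥ C·(n + log(1/δ))/ε²`, there is a
measurable learner `A` on samples of size `m` such that for every Borel probability
measure `p`, with `p^{⊗m}`-probability at least `1 - δ`,
`TV(A(S), p) ≤ 2 · min_i TV(p, q_i) + ε`. -/
theorem improper_upper_bound_sample_complexity :
    ∃ C : ℝ, 0 < C ∧
      ∀ (d : ℕ), 1 ≤ d →
      ∀ (n : ℕ), 1 ≤ n →
      ∀ (q : Fin n → Measure (Fin d → ℝ)), (∀ i, IsProbabilityMeasure (q i)) →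
      ∀ (ε δ : ℝ), ε ∈ Set.Ioo (0:ℝ) 1 → δ ∈ Set.Ioo (0:ℝ) 1 →
      ∀ (m : ℕ), C * ((n : ℝ) + Real.log (1 / δ)) / ε ^ 2 ≤ (m : ℝ) →
        ∃ A : (Fin m → (Fin d → ℝ)) → Measure (Fin d → ℝ),
          Measurable A ∧ (∀ S, IsProbabilityMeasure (A S)) ∧
          ∀ p : Measure (Fin d → ℝ), IsProbabilityMeasure p →
            ENNReal.ofReal (1 - δ) ≤
              Measure.pi (fun _ : Fin m => p)
                {S | tv (A S) p ≤ 2 * (⨅ i, tv p (q i)) + ε} := by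
  refine ⟨170000, by norm_num, fun d _ n hn q hq ε δ hε hδ m hm => ?_⟩
  have : Nonempty (Fin n) := ⟨⟨0, hn⟩⟩
  obtain ⟨r, hr⟩ := exists_pow_lt_of_lt_one hε.1 (show (7 / 8 : ℝ) < 1 by norm_num)
  obtain ⟨D, -, hD, hDp⟩ := learnable_tv_le_add (q := fun i => ⟨q i, hq i⟩) r hr.le hδ.1 hδ.2.le m
    (by simpa using hm)
  refine ⟨fun S => D S, fun s _ => hD {P | (P : Measure (Fin d → ℝ)) ∈ s},
    fun S => inferInstance, fun p hp => ?_⟩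
  have hbad := hDp ⟨p, hp⟩
  have hsub : {S | ¬ tv (D S : Measure (Fin d → ℝ)) p ≤ 2 * (⨅ i, tv p (q i)) + ε} ⊆
      {S | ¬ ∀ i, tv (D S : Measure (Fin d → ℝ)) (q i) ≤ tv p (q i) + ε} := by
    refine fun S hS hgood => hS ?_
    obtain ⟨i, hi⟩ := exists_eq_ciInf_of_finite (f := fun i => tv p (q i))
    have h1 := hgood i
    have h2 := tv_triangle (D S : Measure (Fin d → ℝ)) (q i) p
    rw [tv_comm (q i) p] at h2
    rw [← hi]
    linarith
  have huniv : (1 : ENNReal) ≤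
      Measure.pi (fun _ : Fin m => p)
        {S | tv (D S : Measure (Fin d → ℝ)) p ≤ 2 * (⨅ i, tv p (q i)) + ε} +
      Measure.pi (fun _ : Fin m => p)
        {S | ¬ tv (D S : Measure (Fin d → ℝ)) p ≤ 2 * (⨅ i, tv p (q i)) + ε} := by
    rw [← measure_univ (μ := Measure.pi fun _ : Fin m => p)]
    refine le_trans (measure_mono fun S _ => ?_) (measure_union_le _ _)
    exact em _
  rw [ENNReal.ofReal_sub _ hδ.1.le, ENNReal.ofReal_one, tsub_le_iff_right]
  exact huniv.trans (add_le_add le_rfl ((measure_mono hsub).trans hbad))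
end

section
/- (Proper learning cannot beat factor 3.) For every α < 3 there exist ε₀ > 0 and Borel probability measures q_1, q_2 on [0,1] with the following property: for every m ∈ ℕ and every Markov kernel A from [0,1]^m to {1,2} (a possibly randomized proper algorithm), there exists a Borel probability measure p on [0,1] such that ∫_{[0,1]^m} A(S)({ i ∈ {1,2} : TV(q_i, p) ≥ α · min{TV(q_1,p), TV(q_2,p)} + ε₀ }) d p^{⊗m}(S) ≥ 1/3. In particular, no proper algorithm can guarantee TV(output, p) ≤ α·opt + ε₀ with success probability greater than 2/3. -/
open MeasureTheory ProbabilityTheory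

open scoped ENNReal NNReal

lemma pi_withDensity_eq {X : Type*} [MeasurableSpace X] {m : ℕ} (U : Measure X)
    [IsProbabilityMeasure U] {f : X → ℝ≥0∞} (hf : Measurable f)
    [IsProbabilityMeasure (U.withDensity f)] :
    Measure.pi (fun _ : Fin m => U.withDensity f) =
      (Measure.pi fun _ : Fin m => U).withDensity fun S => ∏ i, f (S i) := by
  refine Measure.pi_eq fun B hB => ?_
  rw [withDensity_apply _ (MeasurableSet.univ_pi hB),
    ← lintegral_indicator (MeasurableSet.univ_pi hB)]
  have hprod : ∀ S : Fin m → X, (Set.univ.pi B).indicator (fun S => ∏ i, f (S i)) S =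
      ∏ i, (B i).indicator f (S i) := by
    intro S
    by_cases hS : S ∈ Set.univ.pi B
    · rw [Set.indicator_of_mem hS]
      exact Finset.prod_congr rfl fun i _ =>
        (Set.indicator_of_mem (hS i (Set.mem_univ i)) f).symm
    · rw [Set.indicator_of_notMem hS]
      simp only [Set.mem_univ_pi, not_forall] at hS
      obtain ⟨i, hi⟩ := hS
      exact (Finset.prod_eq_zero (Finset.mem_univ i) (Set.indicator_of_notMem hi f)).symm
  simp_rw [hprod]
  have hm : ∀ i, Measurable ((B i).indicator f) := fun i => hf.indicator (hB i)
  have := lintegral_prod_eq_prod_lintegral_of_indepFun (μ := Measure.pi fun _ : Fin m => U)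
    Finset.univ (fun i S => (B i).indicator f (S i))
    (iIndepFun_pi fun i => (hm i).aemeasurable)
    (fun i => (hm i).comp (measurable_pi_apply i))
  rw [this]
  refine Finset.prod_congr rfl fun i _ => ?_
  rw [(measurePreserving_eval (fun _ : Fin m => U) i).lintegral_comp (hm i),
    lintegral_indicator (hB i), withDensity_apply _ (hB i)]

lemma sum_prod_comp_injective {ι κ α R : Type*} [Fintype ι] [Fintype κ] [DecidableEq κ] [Fintype α]
    [CommSemiring R] {β : ι → κ} (hβ : Function.Injective β) (F : ι → α → R)
    (hF : ∀ i, ∑ a, F i a = Fintype.card α) :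
    ∑ c : κ → α, ∏ i, F i (c (β i)) = Fintype.card (κ → α) := by
  classical
  have h : ∀ c : κ → α, ∏ i, F i (c (β i)) =
      ∏ j, ∏ i with β i = j, F i (c j) := by
    intro c
    rw [← Finset.prod_fiberwise Finset.univ β]
    refine Finset.prod_congr rfl fun j _ => Finset.prod_congr rfl fun i hi => ?_
    rw [(Finset.mem_filter.1 hi).2]
  simp_rw [h]
  rw [← Fintype.prod_sum fun j a => ∏ i with β i = j, F i a]
  have hj : ∀ j, ∑ a, ∏ i with β i = j, F i a = Fintype.card α := by
    intro j
    by_cases hj : ∃ i, β i = j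
    · obtain ⟨i, rfl⟩ := hj
      simp_rw [hβ.eq_iff, Finset.prod_filter]
      simp [hF]
    · push Not at hj
      simp [hj]
  simp [hj]

lemma measure_pi_not_injective_le {X : Type*} [MeasurableSpace X] (U : Measure X)
    [IsProbabilityMeasure U] {m N : ℕ} {b : X → Fin N} (hb : Measurable b)
    (hU : ∀ j, U (b ⁻¹' {j}) ≤ (N : ℝ≥0∞)⁻¹) :
    (Measure.pi fun _ : Fin m => U) {S | ¬ Function.Injective (b ∘ S)} ≤ m * m * (N : ℝ≥0∞)⁻¹ := by
  have hpair : ∀ i j : Fin m, (Measure.pi fun _ : Fin m => U) {S | i ≠ j ∧ b (S i) = b (S j)} ≤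
      (N : ℝ≥0∞)⁻¹ := by
    intro i j
    by_cases hij : i = j
    · simp [hij]
    have hind := (iIndepFun_pi (μ := fun _ : Fin m => U) (X := fun _ => b)
      fun _ => hb.aemeasurable).indepFun hij
    have hsub : {S : Fin m → X | i ≠ j ∧ b (S i) = b (S j)} ⊆
        ⋃ a, ((fun S => b (S i)) ⁻¹' {a} ∩ (fun S => b (S j)) ⁻¹' {a}) := by
      intro S hS
      simpa using hS.2.symm
    have hfib : ∀ (i : Fin m) (a : Fin N),
        (Measure.pi fun _ : Fin m => U) ((fun S => b (S i)) ⁻¹' {a}) ≤ (N : ℝ≥0∞)⁻¹ := by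
      intro i a
      have := (measurePreserving_eval (fun _ : Fin m => U) i).measure_preimage
        (hb (measurableSet_singleton a)).nullMeasurableSet
      exact this.le.trans (hU a)
    calc _ ≤ ∑ a, (Measure.pi fun _ : Fin m => U)
          ((fun S => b (S i)) ⁻¹' {a} ∩ (fun S => b (S j)) ⁻¹' {a}) :=
          (measure_mono hsub).trans (measure_iUnion_fintype_le _ _)
      _ ≤ ∑ _a : Fin N, (N : ℝ≥0∞)⁻¹ * (N : ℝ≥0∞)⁻¹ := by
          refine Finset.sum_le_sum fun a _ => ?_
          rw [hind.measure_inter_preimage_eq_mul _ _ (measurableSet_singleton a)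
            (measurableSet_singleton a)]
          exact mul_le_mul' (hfib i a) (hfib j a)
      _ ≤ (N : ℝ≥0∞)⁻¹ := by
          simp only [Finset.sum_const, Finset.card_univ, Fintype.card_fin, nsmul_eq_mul]
          rw [← mul_assoc]
          exact mul_le_of_le_one_left' (ENNReal.mul_inv_le_one _)
  have hsub : {S : Fin m → X | ¬ Function.Injective (b ∘ S)} ⊆
      ⋃ i, ⋃ j, {S : Fin m → X | i ≠ j ∧ b (S i) = b (S j)} := by
    intro S hS
    simp only [Set.mem_ofPred_eq, Function.Injective, not_forall] at hS
    obtain ⟨i, j, h, hij⟩ := hS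
    simp only [Set.mem_iUnion]
    exact ⟨i, j, hij, h⟩
  calc _ ≤ ∑ i : Fin m, ∑ j : Fin m,
        (Measure.pi fun _ : Fin m => U) {S | i ≠ j ∧ b (S i) = b (S j)} :=
        (measure_mono hsub).trans <| (measure_iUnion_fintype_le _ _).trans <|
          Finset.sum_le_sum fun i _ => measure_iUnion_fintype_le _ _
    _ ≤ ∑ _i : Fin m, ∑ _j : Fin m, (N : ℝ≥0∞)⁻¹ :=
        Finset.sum_le_sum fun i _ => Finset.sum_le_sum fun j _ => hpair i j
    _ = _ := by simp [mul_assoc]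

lemma exists_equipartition_unitInterval (M : ℕ) :
    ∃ b : unitInterval → Fin (M + 1), Measurable b ∧
      ∀ j, volume (b ⁻¹' {j}) ≤ ((M + 1 : ℕ) : ℝ≥0∞)⁻¹ := by
  refine ⟨fun t => ⟨min ⌊((M : ℝ) + 1) * t⌋₊ M, by omega⟩, ?_, fun j => ?_⟩
  · have h : Measurable fun t : unitInterval => min ⌊((M : ℝ) + 1) * t⌋₊ M :=
      (Nat.measurable_floor.comp (measurable_subtype_coe.const_mul _)).min measurable_const
    exact measurable_to_countable' fun j => by
      convert h (measurableSet_singleton (j : ℕ)) using 1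
      ext t
      simp [Fin.ext_iff]
  · have hM : (0 : ℝ) < M + 1 := by positivity
    have hj : (j : ℝ) + 1 ≤ M + 1 := by exact_mod_cast j.2
    have hle : (fun t : unitInterval =>
          (⟨min ⌊((M : ℝ) + 1) * t⌋₊ M, by omega⟩ : Fin (M + 1))) ⁻¹' {j} ⊆
        Set.Icc ⟨j / (M + 1), by positivity, by rw [div_le_one hM]; linarith⟩
          ⟨(j + 1) / (M + 1), by positivity, by rwa [div_le_one hM]⟩ := by
      intro t ht
      simp only [Set.mem_preimage, Set.mem_singleton_iff, Fin.ext_iff] at ht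
      have h1 : (j : ℕ) ≤ ⌊((M : ℝ) + 1) * t⌋₊ := by omega
      have h0 : 0 ≤ ((M : ℝ) + 1) * t := mul_nonneg hM.le t.2.1
      have h2 := (Nat.le_floor_iff h0).1 h1
      have h3 : ((M : ℝ) + 1) * t ≤ j + 1 := by
        by_cases hf : ⌊((M : ℝ) + 1) * t⌋₊ ≤ M
        · have : ⌊((M : ℝ) + 1) * t⌋₊ = j := by omega
          rw [← this]
          exact (Nat.lt_floor_add_one _).le
        · have : (j : ℕ) = M := by omega
          rw [this]
          exact mul_le_of_le_one_right hM.le t.2.2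
      refine ⟨?_, ?_⟩
      · change (j : ℝ) / (M + 1) ≤ t
        rw [div_le_iff₀ hM]; linarith
      · change (t : ℝ) ≤ (j + 1) / (M + 1)
        rw [le_div_iff₀ hM]; linarith
    refine (measure_mono hle).trans ?_
    rw [unitInterval.volume_Icc]
    apply le_of_eq
    rw [← ENNReal.ofReal_natCast, ← ENNReal.ofReal_inv_of_pos (by positivity)]
    congr 1
    push_cast
    field_simp
    ring

lemma uniformOn_univ_fin_singleton (k : ℕ) (a : Fin (k + 1)) :
    uniformOn (Set.univ : Set (Fin (k + 1))) {a} = ((k + 1 : ℕ) : ℝ≥0∞)⁻¹ := by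
  rw [uniformOn_univ]
  simp

lemma exists_measure_with_hidden_labels (n : ℕ) :
    ∃ (U : Measure unitInterval) (s : unitInterval → Fin 2) (σ : unitInterval → Fin (n + 2)),
      IsProbabilityMeasure U ∧ Measurable s ∧ Measurable σ ∧ ∀ M : ℕ,
        ∃ b : unitInterval → Fin (M + 1), Measurable b ∧
          (∀ j, U (b ⁻¹' {j}) ≤ ((M + 1 : ℕ) : ℝ≥0∞)⁻¹) ∧
          ∀ (c : Fin (M + 1) → Fin (n + 2)) (i : Fin 2) (a : Bool),
            U {x | s x = i ∧ decide (σ x = c (b x)) = a} =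
              ((if a then 1 else (n : ℝ≥0) + 1) / (2 * (n + 2)) : ℝ≥0) := by
  have hI : Uncountable unitInterval := by
    rw [← not_countable_iff]
    intro h
    simpa using (Set.countable_univ (α := unitInterval)).measure_zero volume
  have : Uncountable (Fin 2 × (Fin (n + 2) × unitInterval)) :=
    Function.Injective.uncountable (f := fun t : unitInterval => ((0 : Fin 2), (0 : Fin (n + 2)), t))
      fun t t' h => by simpa using h
  let φ : unitInterval ≃ᵐ Fin 2 × (Fin (n + 2) × unitInterval) :=
    PolishSpace.measurableEquivOfNotCountable (not_countable) (not_countable)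
  let ν₁ := uniformOn (Set.univ : Set (Fin 2))
  let ν₂ := uniformOn (Set.univ : Set (Fin (n + 2)))
  have h₁ : IsProbabilityMeasure ν₁ := isProbabilityMeasure_uniformOn Set.finite_univ Set.univ_nonempty
  have h₂ : IsProbabilityMeasure ν₂ := isProbabilityMeasure_uniformOn Set.finite_univ Set.univ_nonempty
  let V := ν₁.prod (ν₂.prod (volume : Measure unitInterval))
  have hV : IsProbabilityMeasure (V.map φ.symm) :=
    Measure.isProbabilityMeasure_map φ.symm.measurable.aemeasurable
  refine ⟨V.map φ.symm, fun x => (φ x).1, fun x => (φ x).2.1, hV, by fun_prop, by fun_prop,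
    fun M => ?_⟩
  obtain ⟨b, hb, hvol⟩ := exists_equipartition_unitInterval M
  refine ⟨fun x => b (φ x).2.2, by fun_prop, fun j => ?_, fun c i a => ?_⟩
  · rw [φ.symm.map_apply]
    have : φ.symm ⁻¹' ((fun x => b (φ x).2.2) ⁻¹' {j}) =
        Set.univ ×ˢ (Set.univ ×ˢ (b ⁻¹' {j})) := by
      ext y
      simp
    rw [this, Measure.prod_prod, Measure.prod_prod]
    simpa using hvol j
  · rw [φ.symm.map_apply]
    let B : Set (Fin (n + 2) × unitInterval) := {y | y.1 = c (b y.2)}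
    have hB : MeasurableSet B :=
      measurableSet_eq_fun measurable_fst
        ((measurable_of_countable c).comp (hb.comp measurable_snd))
    have hBval : (ν₂.prod (volume : Measure unitInterval)) B = ((n + 1 + 1 : ℕ) : ℝ≥0∞)⁻¹ := by
      rw [Measure.prod_apply_symm hB]
      have : ∀ t, ν₂ ((fun l => (l, t)) ⁻¹' B) = ((n + 1 + 1 : ℕ) : ℝ≥0∞)⁻¹ := fun t =>
        uniformOn_univ_fin_singleton (n + 1) (c (b t))
      simp_rw [this]
      simp
    have hset : φ.symm ⁻¹' {x | (φ x).1 = i ∧ decide ((φ x).2.1 = c (b (φ x).2.2)) = a} =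
        {i} ×ˢ (if a then B else Bᶜ) := by
      ext y
      cases a <;> simp [B]
    rw [hset, Measure.prod_prod, uniformOn_univ_fin_singleton 1 i]
    cases a
    · simp only [Bool.false_eq_true, if_false]
      rw [prob_compl_eq_one_sub hB, hBval]
      rw [← ENNReal.toReal_eq_toReal_iff' (by finiteness) (by finiteness), ENNReal.toReal_mul,
        ENNReal.toReal_sub_of_le (by simp) (by simp)]
      simp only [ENNReal.toReal_inv, ENNReal.toReal_natCast, ENNReal.coe_toReal,
        ENNReal.toReal_one]
      push_cast
      field_simp
      ring
    · simp only [if_true]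
      rw [hBval, ← ENNReal.toReal_eq_toReal_iff' (by finiteness) (by finiteness)]
      simp only [ENNReal.toReal_mul, ENNReal.toReal_inv, ENNReal.toReal_natCast,
        ENNReal.coe_toReal]
      push_cast
      field_simp
      ring

lemma abs_measure_sub_le_tv {X : Type*} [MeasurableSpace X] (p q : Measure X)
    [IsProbabilityMeasure p] [IsProbabilityMeasure q] {B : Set X} (hB : MeasurableSet B) :
    |(p B).toReal - (q B).toReal| ≤ tv p q := by
  refine le_ciSup (f := fun A : {A : Set X // MeasurableSet A} =>
    |(p A.1).toReal - (q A.1).toReal|) ⟨1, ?_⟩ ⟨B, hB⟩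
  rintro _ ⟨A, rfl⟩
  have hp : (p A.1).toReal ≤ 1 := measureReal_le_one
  have hq : (q A.1).toReal ≤ 1 := measureReal_le_one
  have hp0 : 0 ≤ (p A.1).toReal := ENNReal.toReal_nonneg
  have hq0 : 0 ≤ (q A.1).toReal := ENNReal.toReal_nonneg
  exact abs_le.2 ⟨by linarith, by linarith⟩

lemma tv_le_of_forall_measure_le_add {X : Type*} [MeasurableSpace X] (p q : Measure X)
    [IsProbabilityMeasure p] [IsProbabilityMeasure q] {d : ℝ≥0}
    (h : ∀ B, MeasurableSet B → p B ≤ q B + d) : tv p q ≤ d := by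
  have hreal : ∀ B, MeasurableSet B → (p B).toReal ≤ (q B).toReal + d := by
    intro B hB
    have := ENNReal.toReal_mono (by finiteness) (h B hB)
    rwa [ENNReal.toReal_add (by finiteness) (by finiteness), ENNReal.coe_toReal] at this
  have : Nonempty {A : Set X // MeasurableSet A} := ⟨⟨∅, MeasurableSet.empty⟩⟩
  refine ciSup_le fun A => abs_le.2 ⟨?_, ?_⟩
  · have h1 := hreal A.1ᶜ A.2.compl
    have h2 : (p A.1ᶜ).toReal = 1 - (p A.1).toReal := probReal_compl_eq_one_sub A.2
    have h3 : (q A.1ᶜ).toReal = 1 - (q A.1).toReal := probReal_compl_eq_one_sub A.2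
    linarith
  · linarith [hreal A.1 A.2]

lemma setLIntegral_pi_le_of_forall_withDensity {X C : Type*} [MeasurableSpace X] [Fintype C]
    [Nonempty C] {m : ℕ} (U : Measure X) [IsProbabilityMeasure U] {f : C → X → ℝ≥0∞}
    (hf : ∀ c, Measurable (f c)) (hprob : ∀ c, IsProbabilityMeasure (U.withDensity (f c)))
    {D : Set (Fin m → X)} (hD : MeasurableSet D)
    (havg : ∀ S ∈ D, ∑ c, ∏ i, f c (S i) = Fintype.card C)
    {a : (Fin m → X) → ℝ≥0∞} (ha : Measurable a) {t : ℝ≥0∞}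
    (hbound : ∀ c, ∫⁻ S, a S ∂(Measure.pi fun _ => U.withDensity (f c)) ≤ t) :
    ∫⁻ S in D, a S ∂(Measure.pi fun _ => U) ≤ t := by
  have hprod : ∀ c, Measurable fun S : Fin m → X => ∏ i, f c (S i) := fun c =>
    Finset.measurable_prod _ fun i _ => (hf c).comp (measurable_pi_apply i)
  have hle : (Fintype.card C : ℝ≥0∞) * ∫⁻ S in D, a S ∂(Measure.pi fun _ => U) ≤
      Fintype.card C * t :=
    calc _ = ∫⁻ S in D, ∑ c, (∏ i, f c (S i)) * a S ∂(Measure.pi fun _ => U) := by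
          rw [← lintegral_const_mul _ ha]
          refine setLIntegral_congr_fun hD fun S hS => ?_
          rw [← Finset.sum_mul, havg S hS]
      _ ≤ ∫⁻ S, ∑ c, (∏ i, f c (S i)) * a S ∂(Measure.pi fun _ => U) :=
          setLIntegral_le_lintegral _ _
      _ = ∑ c, ∫⁻ S, a S ∂(Measure.pi fun _ => U.withDensity (f c)) := by
          rw [lintegral_finsetSum _ fun c _ => by exact (hprod c).mul ha]
          refine Finset.sum_congr rfl fun c _ => ?_
          have := hprob c
          rw [pi_withDensity_eq U (hf c), lintegral_withDensity_eq_lintegral_mul _ (hprod c) ha]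
          rfl
      _ ≤ ∑ _c : C, t := Finset.sum_le_sum fun c _ => hbound c
      _ = _ := by simp
  rwa [ENNReal.mul_le_mul_iff_right (by simp) (by simp)] at hle

/-- Density of the `τ`-th hypothesis on the part of the domain with label `i`. -/
noncomputable def hypothesisDensity (n : ℕ) (τ i : Fin 2) : ℝ≥0 :=
  if i = τ then (n + 2) / (n + 1) else n / (n + 1)

/-- Density of a target close to the `τ`-th hypothesis on the part of the domain with label `i`,
where `e` records whether the point lies in the hidden exceptional set. -/
noncomputable def targetDensity (n : ℕ) (τ i : Fin 2) (e : Bool) : ℝ≥0 :=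
  if i = τ then (if e then 0 else (n + 2) / (n + 1)) else (if e then 2 else n / (n + 1))

lemma sum_targetDensity (n : ℕ) (τ i : Fin 2) (l : Fin (n + 2)) :
    ∑ a, (targetDensity n τ i (decide (l = a)) : ℝ≥0∞) = Fintype.card (Fin (n + 2)) := by
  have h : ∑ a, targetDensity n τ i (decide (l = a)) = n + 2 := by
    rw [← Finset.add_sum_erase _ _ (Finset.mem_univ l)]
    have : ∀ a ∈ Finset.univ.erase l, targetDensity n τ i (decide (l = a)) =
        targetDensity n τ i false := fun a ha => by
      rw [decide_eq_false (Finset.ne_of_mem_erase ha).symm]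
    rw [Finset.sum_congr rfl this]
    simp only [decide_true, Finset.sum_const, Finset.card_erase_of_mem (Finset.mem_univ l),
      Finset.card_univ, Fintype.card_fin, nsmul_eq_mul, targetDensity]
    by_cases h : i = τ
    · simp [h]
      field_simp
    · simp [h]
      field_simp
      ring
  rw [← ENNReal.ofNNReal_finsetSum, h]
  simp

section LabelledSpace

variable {X : Type*} [MeasurableSpace X] {U : Measure X} {s : X → Fin 2} {e : X → Bool} {n : ℕ}

lemma withDensity_label_apply (hs : Measurable s) (he : Measurable e)
    (hlaw : ∀ i a, U {x | s x = i ∧ e x = a} =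
      ((if a then 1 else (n : ℝ≥0) + 1) / (2 * (n + 2)) : ℝ≥0))
    (g : Fin 2 → Bool → ℝ≥0) (T : Set (Fin 2 × Bool)) [DecidablePred (· ∈ T)] :
    U.withDensity (fun x => (g (s x) (e x) : ℝ≥0∞)) ((fun x => (s x, e x)) ⁻¹' T) =
      (∑ i, ∑ a, if (i, a) ∈ T then
        g i a * ((if a then 1 else (n : ℝ≥0) + 1) / (2 * (n + 2))) else 0 : ℝ≥0) := by
  have hse : Measurable fun x => (s x, e x) := hs.prodMk he
  have hT : MeasurableSet T := T.toFinite.measurableSet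
  have hmap : ∀ y : Fin 2 × Bool, U.map (fun x => (s x, e x)) {y} =
      ((if y.2 then 1 else (n : ℝ≥0) + 1) / (2 * (n + 2)) : ℝ≥0) := by
    intro y
    rw [Measure.map_apply hse (measurableSet_singleton y), ← hlaw y.1 y.2]
    congr 1
    ext x
    simp [Prod.ext_iff]
  rw [withDensity_apply _ (hse hT),
    ← setLIntegral_map (f := fun y : Fin 2 × Bool => (g y.1 y.2 : ℝ≥0∞)) hT
      (measurable_of_countable _) hse, ← lintegral_indicator hT, lintegral_fintype,
    Fintype.sum_prod_type]
  simp only [hmap, Set.indicator_apply, ENNReal.ofNNReal_finsetSum, apply_ite ENNReal.ofNNReal,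
    ENNReal.coe_mul, ENNReal.coe_zero, ite_mul, zero_mul]

lemma isProbabilityMeasure_hypothesis (hs : Measurable s) (he : Measurable e)
    (hlaw : ∀ i a, U {x | s x = i ∧ e x = a} =
      ((if a then 1 else (n : ℝ≥0) + 1) / (2 * (n + 2)) : ℝ≥0)) (τ : Fin 2) :
    IsProbabilityMeasure (U.withDensity fun x => (hypothesisDensity n τ (s x) : ℝ≥0∞)) := by
  classical
  constructor
  have := withDensity_label_apply hs he hlaw (fun i _ => hypothesisDensity n τ i) Set.univ
  rw [Set.preimage_univ] at this
  rw [this, ENNReal.coe_eq_one]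
  fin_cases τ <;> simp [hypothesisDensity] <;> field_simp <;> ring

lemma isProbabilityMeasure_target (hs : Measurable s) (he : Measurable e)
    (hlaw : ∀ i a, U {x | s x = i ∧ e x = a} =
      ((if a then 1 else (n : ℝ≥0) + 1) / (2 * (n + 2)) : ℝ≥0)) (τ : Fin 2) :
    IsProbabilityMeasure (U.withDensity fun x => (targetDensity n τ (s x) (e x) : ℝ≥0∞)) := by
  classical
  constructor
  have := withDensity_label_apply hs he hlaw (targetDensity n τ) Set.univ
  rw [Set.preimage_univ] at this
  rw [this, ENNReal.coe_eq_one]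
  fin_cases τ <;> simp [targetDensity] <;> field_simp <;> ring

lemma tv_hypothesis_target_le (hs : Measurable s) (he : Measurable e)
    (hlaw : ∀ i a, U {x | s x = i ∧ e x = a} =
      ((if a then 1 else (n : ℝ≥0) + 1) / (2 * (n + 2)) : ℝ≥0)) (τ : Fin 2) :
    tv (U.withDensity fun x => (hypothesisDensity n τ (s x) : ℝ≥0∞))
      (U.withDensity fun x => (targetDensity n τ (s x) (e x) : ℝ≥0∞)) ≤ 1 / (2 * (n + 1)) := by
  have := isProbabilityMeasure_hypothesis hs he hlaw τ
  have := isProbabilityMeasure_target hs he hlaw τ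
  have hp : Measurable fun x => (targetDensity n τ (s x) (e x) : ℝ≥0∞) :=
    (measurable_of_countable fun y : Fin 2 × Bool => (targetDensity n τ y.1 y.2 : ℝ≥0∞)).comp
      (hs.prodMk he)
  have hZ : MeasurableSet {x | s x = τ ∧ e x = true} :=
    (hs (measurableSet_singleton τ)).inter (he (measurableSet_singleton true))
  have key := tv_le_of_forall_measure_le_add
    (U.withDensity fun x => (hypothesisDensity n τ (s x) : ℝ≥0∞))
    (U.withDensity fun x => (targetDensity n τ (s x) (e x) : ℝ≥0∞))
    (d := 1 / (2 * (n + 1))) fun B hB => ?_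
  · simpa using key
  rw [withDensity_apply _ hB, withDensity_apply _ hB]
  calc ∫⁻ x in B, (hypothesisDensity n τ (s x) : ℝ≥0∞) ∂U
      ≤ ∫⁻ x in B, ((targetDensity n τ (s x) (e x) : ℝ≥0∞) +
          {x | s x = τ ∧ e x = true}.indicator
            (fun _ => (((n + 2) / (n + 1) : ℝ≥0) : ℝ≥0∞)) x) ∂U := by
        refine lintegral_mono fun x => ?_
        by_cases h1 : s x = τ <;> by_cases h2 : e x = true <;>
          simp [hypothesisDensity, targetDensity, h1, h2]
        norm_cast
        exact ENNReal.div_le_of_le_mul (by norm_cast; omega)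
    _ = ∫⁻ x in B, (targetDensity n τ (s x) (e x) : ℝ≥0∞) ∂U +
          ∫⁻ x in B, {x | s x = τ ∧ e x = true}.indicator
            (fun _ => (((n + 2) / (n + 1) : ℝ≥0) : ℝ≥0∞)) x ∂U := lintegral_add_left hp _
    _ ≤ _ := by
        gcongr
        refine (setLIntegral_le_lintegral _ _).trans ?_
        rw [lintegral_indicator_const hZ, hlaw, ← ENNReal.coe_mul, ENNReal.coe_le_coe]
        apply le_of_eq
        simp
        field_simp

lemma le_tv_hypothesis_target (hs : Measurable s) (he : Measurable e)
    (hlaw : ∀ i a, U {x | s x = i ∧ e x = a} =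
      ((if a then 1 else (n : ℝ≥0) + 1) / (2 * (n + 2)) : ℝ≥0)) {τ ρ : Fin 2} (hρ : ρ ≠ τ) :
    (3 * n + 2) / (2 * (n + 1) * (n + 2)) ≤
      tv (U.withDensity fun x => (hypothesisDensity n ρ (s x) : ℝ≥0∞))
        (U.withDensity fun x => (targetDensity n τ (s x) (e x) : ℝ≥0∞)) := by
  classical
  have := isProbabilityMeasure_hypothesis hs he hlaw ρ
  have := isProbabilityMeasure_target hs he hlaw τ
  let T : Set (Fin 2 × Bool) := {y | y = (τ, true) ∨ y = (ρ, false)}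
  refine le_trans ?_ (abs_measure_sub_le_tv _ _ ((hs.prodMk he) T.toFinite.measurableSet))
  have hq := withDensity_label_apply hs he hlaw (fun i _ => hypothesisDensity n ρ i) T
  have hp := withDensity_label_apply hs he hlaw (targetDensity n τ) T
  rw [hq, hp, ENNReal.coe_toReal, ENNReal.coe_toReal]
  refine le_trans (le_of_eq ?_) (le_abs_self _)
  fin_cases τ <;> fin_cases ρ <;> simp [T, hypothesisDensity, targetDensity] at hρ ⊢ <;>
    field_simp <;> ring

end LabelledSpace

/-- **Proper learning cannot beat factor 3.** For every `α < 3` there exist `ε₀ > 0` and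
Borel probability measures `q 0, q 1` on `[0,1]` such that for every sample size `m` and
every Markov kernel `A` from `[0,1]^m` to `{0,1}` (a possibly randomized proper learner),
there is a Borel probability target `p` such that with probability at least `1/3` (over
`S ∼ p^{⊗m}` and the algorithm's randomness) the output `q i` satisfies
`TV(q i, p) ≥ α · min{TV(q 0,p), TV(q 1,p)} + ε₀`. -/
theorem proper_cannot_beat_three (α : ℝ) (hα : α < 3) :
    ∃ ε₀ : ℝ, 0 < ε₀ ∧
      ∃ q : Fin 2 → Measure unitInterval, (∀ i, IsProbabilityMeasure (q i)) ∧
        ∀ (m : ℕ) (A : Kernel (Fin m → unitInterval) (Fin 2)), IsMarkovKernel A →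
          ∃ p : Measure unitInterval, IsProbabilityMeasure p ∧
            (1 : ℝ) / 3 ≤
              ∫ S, ((A S) {i | α * min (tv (q 0) p) (tv (q 1) p) + ε₀ ≤ tv (q i) p}).toReal
                ∂(Measure.pi fun _ : Fin m => p) := by
  obtain ⟨n, hn⟩ := exists_nat_gt (2 * (max α 0) / (3 - max α 0))
  have hα' : max α 0 < 3 := max_lt hα (by norm_num)
  have hn' : max α 0 * (n + 2) < 3 * n + 2 := by
    rw [div_lt_iff₀ (by linarith)] at hn
    nlinarith
  obtain ⟨U, s, σ, hU, hs, hσ, hblock⟩ := exists_measure_with_hidden_labels n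
  have he : ∀ {M : ℕ} {b : unitInterval → Fin (M + 1)} (_ : Measurable b)
      (c : Fin (M + 1) → Fin (n + 2)), Measurable fun x => decide (σ x = c (b x)) :=
    fun hb c => (measurable_of_countable fun y : Fin (n + 2) × Fin (n + 2) =>
      decide (y.1 = y.2)).comp (hσ.prodMk ((measurable_of_countable c).comp hb))
  refine ⟨(3 * n + 2 - max α 0 * (n + 2)) / (2 * (n + 1) * (n + 2)),
    div_pos (by linarith) (by positivity),
    fun τ => U.withDensity fun x => (hypothesisDensity n τ (s x) : ℝ≥0∞), fun τ => ?_,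
    fun m A hA => ?_⟩
  · obtain ⟨b, hb, -, hlaw⟩ := hblock 0
    exact isProbabilityMeasure_hypothesis hs (he hb fun _ => 0) (hlaw fun _ => 0) τ
  obtain ⟨b, hb, hfib, hlaw⟩ := hblock (3 * (m * m))
  by_contra! hcon
  let q : Fin 2 → Measure unitInterval :=
    fun τ => U.withDensity fun x => (hypothesisDensity n τ (s x) : ℝ≥0∞)
  let f : Fin 2 → (Fin (3 * (m * m) + 1) → Fin (n + 2)) → unitInterval → ℝ≥0∞ :=
    fun τ c x => (targetDensity n τ (s x) (decide (σ x = c (b x))) : ℝ≥0∞)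
  have hf : ∀ τ c, Measurable (f τ c) := fun τ c =>
    (measurable_of_countable fun y : Fin 2 × Bool => (targetDensity n τ y.1 y.2 : ℝ≥0∞)).comp
      (hs.prodMk (he hb c))
  have hprob : ∀ τ c, IsProbabilityMeasure (U.withDensity (f τ c)) := fun τ c =>
    isProbabilityMeasure_target hs (he hb c) (hlaw c) τ
  have hbad : ∀ {τ ρ : Fin 2} (_ : ρ ≠ τ) c,
      α * min (tv (q 0) (U.withDensity (f τ c))) (tv (q 1) (U.withDensity (f τ c))) +
        (3 * n + 2 - max α 0 * (n + 2)) / (2 * (n + 1) * (n + 2)) ≤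
        tv (q ρ) (U.withDensity (f τ c)) := by
    intro τ ρ hρ c
    refine le_trans ?_ (le_tv_hypothesis_target hs (he hb c) (hlaw c) hρ)
    have hnear := tv_hypothesis_target_le hs (he hb c) (hlaw c) τ
    have hmin : min (tv (q 0) (U.withDensity (f τ c))) (tv (q 1) (U.withDensity (f τ c))) ≤
        1 / (2 * (n + 1)) := by
      refine le_trans ?_ hnear
      fin_cases τ
      · exact min_le_left _ _
      · exact min_le_right _ _
    have hmin0 : 0 ≤ min (tv (q 0) (U.withDensity (f τ c))) (tv (q 1) (U.withDensity (f τ c))) :=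
      le_min (Real.iSup_nonneg fun _ => abs_nonneg _) (Real.iSup_nonneg fun _ => abs_nonneg _)
    have h1 := mul_le_mul_of_nonneg_right (le_max_left α 0) hmin0
    have h2 := mul_le_mul_of_nonneg_left hmin (le_max_right α 0)
    calc _ ≤ max α 0 * (1 / (2 * (n + 1))) +
          (3 * n + 2 - max α 0 * (n + 2)) / (2 * ((n : ℝ) + 1) * (n + 2)) := by linarith
      _ = _ := by
        field_simp
        ring
  have hmeasA : ∀ B : Set (Fin 2), Measurable fun S => A S B := fun B =>
    A.measurable_coe B.toFinite.measurableSet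
  have hrisk : ∀ {τ ρ : Fin 2} (_ : ρ ≠ τ) c,
      ∫⁻ S, A S {ρ} ∂(Measure.pi fun _ : Fin m => U.withDensity (f τ c)) ≤ 3⁻¹ := by
    intro τ ρ hρ c
    have h := hcon _ (hprob τ c)
    rw [integral_toReal (hmeasA _).aemeasurable
      (Filter.Eventually.of_forall fun S => measure_lt_top _ _)] at h
    refine le_trans ?_
      ((ENNReal.toReal_le_toReal (ne_of_lt ?_) (by simp)).1 (h.le.trans_eq (by simp)))
    · exact lintegral_mono fun S => measure_mono (Set.singleton_subset_iff.2 (hbad hρ c))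
    · exact (lintegral_mono fun S => prob_le_one).trans_lt (by simp)
  let D : Set (Fin m → unitInterval) := {S | Function.Injective (b ∘ S)}
  have hD : MeasurableSet D :=
    (measurable_pi_lambda (fun (S : Fin m → unitInterval) i => b (S i))
      fun i => hb.comp (measurable_pi_apply i))
      (Set.toFinite {β : Fin m → Fin (3 * (m * m) + 1) | Function.Injective β}).measurableSet
  have havg : ∀ τ, ∀ S ∈ D, ∑ c, ∏ i, f τ c (S i) =
      (Fintype.card (Fin (3 * (m * m) + 1) → Fin (n + 2)) : ℝ≥0∞) := fun τ S hS =>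
    sum_prod_comp_injective (β := b ∘ S) hS
      (fun i a => (targetDensity n τ (s (S i)) (decide (σ (S i) = a)) : ℝ≥0∞))
      fun i => sum_targetDensity n τ (s (S i)) (σ (S i))
  have hhalf : ∀ {τ ρ : Fin 2} (_ : ρ ≠ τ),
      ∫⁻ S in D, A S {ρ} ∂(Measure.pi fun _ => U) ≤ 3⁻¹ := fun {τ ρ} hρ =>
    setLIntegral_pi_le_of_forall_withDensity U (hf τ) (hprob τ) hD (havg τ) (hmeasA {ρ})
      (hrisk hρ)
  have hDle : (Measure.pi fun _ : Fin m => U) D ≤ 3⁻¹ + 3⁻¹ := by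
    calc _ = ∫⁻ S in D, (A S {0} + A S {1}) ∂(Measure.pi fun _ => U) := by
          rw [← setLIntegral_one]
          refine lintegral_congr fun S => ?_
          rw [← measure_union (by simp) (measurableSet_singleton 1), ← measure_univ (μ := A S)]
          congr 1
          ext i
          fin_cases i <;> simp
      _ ≤ _ := by
          rw [lintegral_add_left (hmeasA {0})]
          exact add_le_add (hhalf (τ := 1) (by simp)) (hhalf (τ := 0) (by simp))
  have hDc := measure_pi_not_injective_le (m := m) U hb hfib
  have hlt : (m : ℝ≥0∞) * m * ((3 * (m * m) + 1 : ℕ) : ℝ≥0∞)⁻¹ < 3⁻¹ := by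
    rw [← ENNReal.toReal_lt_toReal (by finiteness) (by finiteness)]
    simp only [ENNReal.toReal_mul, ENNReal.toReal_inv, ENNReal.toReal_natCast,
      ENNReal.toReal_ofNat]
    push_cast
    rw [← div_eq_mul_inv, ← one_div, div_lt_div_iff₀ (by positivity) (by norm_num)]
    linarith
  have htotal : (1 : ℝ≥0∞) < 1 :=
    calc (1 : ℝ≥0∞) = (Measure.pi fun _ : Fin m => U) D + (Measure.pi fun _ : Fin m => U) Dᶜ := by
          rw [measure_add_measure_compl hD, measure_univ]
      _ < (3⁻¹ + 3⁻¹) + 3⁻¹ :=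
          ENNReal.add_lt_add_of_le_of_lt (by finiteness) hDle (hDc.trans_lt hlt)
      _ = 1 := ENNReal.inv_three_add_inv_three
  exact lt_irrefl _ htotal
end

section
/- (Static surrogate family.) Let X be a nonempty finite set and let q_1, …, q_n ∈ Δ(X). Then there exists a family F of subsets of X, closed under complementation, such that: (1) Q_TV = Q_F, where Q_F is defined via the semi-metric d_F(p,q) = max_{A ∈ F} (p(A) − q(A)); and (2) the VC dimension of F is at most 10n. -/
open Finset

/-- A probability mass function on a finite set: nonnegative and summing to `1`. -/
def IsPMF {X : Type*} [Fintype X] (p : X → ℝ) : Prop :=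
  (∀ x, 0 ≤ p x) ∧ ∑ x, p x = 1

/-- Total variation distance between two distributions on a finite set:
`TV(p,q) = max_{A ⊆ X} |p(A) − q(A)|`. -/
noncomputable def tvFin {X : Type*} [Fintype X] (p q : X → ℝ) : ℝ :=
  ⨆ A : Finset X, |∑ x ∈ A, (p x - q x)|

/-- `Q_TV`: the set of vectors dominating the TV-distance vector of some distribution. -/
def QTV {X : Type*} [Fintype X] {n : ℕ} (q : Fin n → X → ℝ) : Set (Fin n → ℝ) :=
  {v | ∃ p : X → ℝ, IsPMF p ∧ ∀ i, tvFin p (q i) ≤ v i}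

/-- The semi-metric `d_F(p,q) = max_{A ∈ F} (p(A) − q(A))` for a family `F` of subsets. -/
noncomputable def dFam {X : Type*} [Fintype X] (F : Set (Set X)) (p q : X → ℝ) : ℝ :=
  ⨆ A : F, ∑ x, (A.1.indicator (fun y => p y - q y) x)

/-- `Q_F`: the set of vectors dominating the `d_F`-distance vector of some
distribution, for a family `F` of subsets. -/
def QFam {X : Type*} [Fintype X] (F : Set (Set X)) {n : ℕ} (q : Fin n → X → ℝ) :
    Set (Fin n → ℝ) :=
  {v | ∃ p : X → ℝ, IsPMF p ∧ ∀ i, dFam F p (q i) ≤ v i}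

/-- A family of subsets `C` shatters a finite set `S` if every subset of `S` is cut out
by a member of `C`. -/
def Shatters {X : Type*} (C : Set (Set X)) (S : Finset X) : Prop :=
  ∀ T ⊆ S, ∃ c ∈ C, c ∩ ↑S = (↑T : Set X)

/-- A theorem of the alternative: a compact convex set either meets the nonpositive orthant or
lies strictly on the positive side of a nonnegative functional. -/
theorem exists_nonneg_functional_pos {ι : Type*} [Fintype ι] {K : Set (ι → ℝ)}
    (hK : Convex ℝ K) (hKc : IsCompact K) (h : ∀ a ∈ K, ∃ k, 0 < a k) :
    ∃ c : ι → ℝ, (∀ k, 0 ≤ c k) ∧ ∀ a ∈ K, 0 < ∑ k, c k * a k := by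
  classical
  have hO : Convex ℝ (Set.Iic (0 : ι → ℝ)) := convex_Iic 0
  have hd : Disjoint K (Set.Iic (0 : ι → ℝ)) := by
    rw [Set.disjoint_left]
    intro a ha ha0
    obtain ⟨k, hk⟩ := h a ha
    exact absurd (ha0 k) (not_le.mpr hk)
  obtain ⟨f, u, v, hu, huv, hv⟩ :=
    geometric_hahn_banach_compact_closed hK hKc hO isClosed_Iic hd
  have hv0 : v < 0 := by simpa using hv 0 (by simp)
  refine ⟨fun k => -f (Pi.single k 1), fun k => ?_, fun a ha => ?_⟩
  · by_contra! hneg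
    have hpos : 0 < f (Pi.single k 1) := by linarith
    have hmem : (v / f (Pi.single k 1)) • (Pi.single k 1 : ι → ℝ) ∈ Set.Iic (0 : ι → ℝ) := by
      intro j
      have hc : v / f (Pi.single k 1) ≤ 0 := (div_neg_of_neg_of_pos hv0 hpos).le
      by_cases hj : j = k
      · subst hj; simpa using hc
      · simp [hj]
    have := hv _ hmem
    rw [map_smul, smul_eq_mul, div_mul_cancel₀ _ hpos.ne'] at this
    exact lt_irrefl _ this
  · have hf : f a = ∑ k, a k * f (Pi.single k 1) := by
      conv_lhs => rw [pi_eq_sum_univ' a]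
      simp [map_sum]
    have : ∑ k, -f (Pi.single k 1) * a k = -f a := by
      rw [hf, ← Finset.sum_neg_distrib]
      exact Finset.sum_congr rfl fun k _ => by ring
    rw [this]
    linarith [hu a ha]

/-- Layer-cake estimate: a signed weight that is at most `v` on every superlevel set of
`g : X → [0, w]` integrates `g` to at most `w * v`. -/
theorem sum_mul_le_of_superlevel_le {X : Type*} [Fintype X] (r g : X → ℝ) {w v : ℝ}
    (hw : 0 ≤ w) (hg0 : ∀ x, 0 ≤ g x) (hgw : ∀ x, g x ≤ w)
    (h : ∀ s, 0 ≤ s → s < w → ∑ x, {y | s < g y}.indicator r x ≤ v) :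
    ∑ x, r x * g x ≤ w * v := by
  classical
  have hintegrable : ∀ x, IntervalIntegrable ((Set.Iio (g x)).indicator fun _ => r x)
      MeasureTheory.volume 0 w := fun x => by
    rw [intervalIntegrable_iff]
    exact ((MeasureTheory.integrableOn_const (by simp)).indicator measurableSet_Iio)
  have hval : ∀ x, ∫ s in (0 : ℝ)..w, (Set.Iio (g x)).indicator (fun _ => r x) s = r x * g x := by
    intro x
    rw [intervalIntegral.integral_of_le hw, ← MeasureTheory.integral_Ico_eq_integral_Ioc,
      MeasureTheory.setIntegral_indicator measurableSet_Iio]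
    have : Set.Ico 0 w ∩ Set.Iio (g x) = Set.Ico 0 (g x) := by
      rw [← Set.Ici_inter_Iio, Set.inter_assoc, Set.Iio_inter_Iio, min_eq_right (hgw x),
        Set.Ici_inter_Iio]
    rw [this]
    simp [hg0 x, mul_comm]
  calc ∑ x, r x * g x
      = ∫ s in (0 : ℝ)..w, ∑ x, (Set.Iio (g x)).indicator (fun _ => r x) s := by
        rw [intervalIntegral.integral_finsetSum fun x _ => hintegrable x]
        exact Finset.sum_congr rfl fun x _ => (hval x).symm
    _ ≤ ∫ _ in (0 : ℝ)..w, v := by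
        refine intervalIntegral.integral_mono_on_of_le_Ioo hw ?_ (by simp) fun s hs => ?_
        · have hsum := IntervalIntegrable.sum Finset.univ fun x _ => hintegrable x
          rwa [Finset.sum_fn] at hsum
        · refine le_trans (le_of_eq ?_) (h s hs.1.le hs.2)
          exact Finset.sum_congr rfl fun x _ => by simp [Set.indicator_apply]
    _ = w * v := by simp

/-- The total weight of the indices preceding `i` when the indices are sorted by `r`. -/
noncomputable def weightBefore {n : ℕ} (r w : Fin n → ℝ) (i : Fin n) : ℝ :=
  ∑ j, w j * if (Tuple.sort r).symm j < (Tuple.sort r).symm i then 1 else 0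

/-- The greedy solution of the fractional covering problem: capacities `w` are used in increasing
order of the cost `r` until the total amount `t` is reached. -/
noncomputable def greedyFill {n : ℕ} (r w : Fin n → ℝ) (t : ℝ) (i : Fin n) : ℝ :=
  min t (weightBefore r w i + w i) - min t (weightBefore r w i)

section Greedy

variable {n : ℕ} {r w : Fin n → ℝ} {t : ℝ}

theorem weightBefore_sort (r w : Fin n → ℝ) (k : Fin n) :
    weightBefore r w (Tuple.sort r k) = ∑ j, if j < k then w (Tuple.sort r j) else 0 := by
  rw [weightBefore, ← Equiv.sum_comp (Tuple.sort r)]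
  simp

theorem sum_greedyFill (ht0 : 0 ≤ t) (ht : t ≤ ∑ i, w i) : ∑ i, greedyFill r w t i = t := by
  set P : ℕ → ℝ := fun m => ∑ j : Fin n, if (j : ℕ) < m then w (Tuple.sort r j) else 0 with hP
  have hstep : ∀ k : Fin n,
      greedyFill r w t (Tuple.sort r k) = min t (P (k + 1)) - min t (P k) := by
    intro k
    have hsucc : P (k + 1) = P k + w (Tuple.sort r k) := by
      have : w (Tuple.sort r k) = ∑ j : Fin n, if j = k then w (Tuple.sort r j) else 0 := by simp
      rw [this, hP, ← Finset.sum_add_distrib]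
      refine Finset.sum_congr rfl fun j _ => ?_
      rcases lt_trichotomy j k with h | h | h
      · have h' : (j : ℕ) < k := h
        simp [h', h.ne, Nat.lt_succ_of_lt h']
      · simp [h]
      · have h' : (k : ℕ) < j := h
        simp [h.ne', h'.not_gt, not_le.mpr h']
    rw [greedyFill, weightBefore_sort, hsucc]
    rfl
  rw [← Equiv.sum_comp (Tuple.sort r), Finset.sum_congr rfl fun k _ => hstep k,
    Fin.sum_univ_eq_sum_range fun m => min t (P (m + 1)) - min t (P m),
    Finset.sum_range_sub fun m => min t (P m)]
  have hPn : P n = ∑ i, w i := by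
    simp only [hP, Fin.is_lt, if_true]
    exact Equiv.sum_comp (Tuple.sort r) w
  have hP0 : P 0 = 0 := by simp [hP]
  rw [hPn, hP0, min_eq_left ht, min_eq_right ht0, sub_zero]

theorem greedyFill_nonneg (hw : ∀ i, 0 ≤ w i) (i : Fin n) : 0 ≤ greedyFill r w t i :=
  sub_nonneg.mpr (min_le_min_left t (le_add_of_nonneg_right (hw i)))

theorem greedyFill_le (hw : ∀ i, 0 ≤ w i) (i : Fin n) : greedyFill r w t i ≤ w i := by
  have := hw i
  unfold greedyFill
  grind

theorem lt_greedyFill_iff {s : ℝ} {i : Fin n} (hs : 0 ≤ s) (hsw : s < w i) :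
    s < greedyFill r w t i ↔ weightBefore r w i < t - s := by
  unfold greedyFill
  grind

theorem weightBefore_add_le (hw : ∀ i, 0 ≤ w i) {i k : Fin n} (h : r i < r k) :
    weightBefore r w i + w i ≤ weightBefore r w k := by
  have hlt : (Tuple.sort r).symm i < (Tuple.sort r).symm k := by
    by_contra! hle
    have := Tuple.monotone_sort r hle
    simp only [Function.comp_apply, Equiv.apply_symm_apply] at this
    exact absurd h this.not_gt
  have : w i = ∑ j : Fin n, if j = i then w j else 0 := by simp
  rw [this, weightBefore, weightBefore, ← Finset.sum_add_distrib]
  refine Finset.sum_le_sum fun j _ => ?_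
  have := hw j
  by_cases hj : j = i
  · subst hj; simp [hlt]
  · by_cases hji : (Tuple.sort r).symm j < (Tuple.sort r).symm i
    · simp [hj, hji, hji.trans hlt]
    · simp only [hj, hji, if_false, mul_zero, add_zero]
      split_ifs <;> simp [this]

theorem sum_mul_greedyFill_le (hr : ∀ i, 0 ≤ r i) (hw : ∀ i, 0 ≤ w i) (ht0 : 0 ≤ t)
    {g : Fin n → ℝ} (hg0 : ∀ i, 0 ≤ g i) (hgw : ∀ i, g i ≤ w i) (ht : t ≤ ∑ i, g i) :
    ∑ i, r i * greedyFill r w t i ≤ ∑ i, r i * g i := by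
  have hsum := sum_greedyFill (r := r) ht0 (ht.trans (Finset.sum_le_sum fun i _ => hgw i))
  by_cases hex : ∃ i, 0 < greedyFill r w t i
  · obtain ⟨k, hk, hmax⟩ := Finset.exists_max_image
      (Finset.univ.filter fun i => 0 < greedyFill r w t i) r (by simpa [Finset.Nonempty] using hex)
    simp only [Finset.mem_filter, Finset.mem_univ, true_and] at hk hmax
    have hterm : ∀ i, r k * (g i - greedyFill r w t i) ≤ r i * (g i - greedyFill r w t i) := by
      intro i
      rcases lt_trichotomy (r i) (r k) with h | h | h
      · have hle := weightBefore_add_le hw h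
        have hfull : greedyFill r w t i = w i := by
          have := hw i
          unfold greedyFill at hk ⊢
          grind
        have := hgw i
        nlinarith
      · rw [h]
      · have hzero : greedyFill r w t i = 0 :=
          le_antisymm (not_lt.mp fun hpos => (hmax i hpos).not_gt h) (greedyFill_nonneg hw i)
        have := hg0 i
        nlinarith
    have h1 := Finset.sum_le_sum fun i (_ : i ∈ Finset.univ) => hterm i
    rw [← Finset.mul_sum] at h1
    simp only [mul_sub, Finset.sum_sub_distrib] at h1
    rw [hsum] at h1
    have := mul_nonneg (hr k) (sub_nonneg.mpr ht)
    nlinarith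
  · push Not at hex
    exact Finset.sum_le_sum fun i _ =>
      mul_le_mul_of_nonneg_left ((hex i).trans (hg0 i)) (hr i)

end Greedy

/-- The family of sets strictly separated from their complement by a linear functional of the
features `φ`. -/
def halfspaceFamily {X κ : Type*} [Fintype κ] (φ : X → κ → ℝ) : Set (Set X) :=
  {A | ∃ a : κ → ℝ, (∀ x ∈ A, 0 < ∑ k, a k * φ x k) ∧ ∀ x ∉ A, ∑ k, a k * φ x k < 0}

theorem compl_mem_halfspaceFamily {X κ : Type*} [Fintype κ] {φ : X → κ → ℝ} {A : Set X}
    (hA : A ∈ halfspaceFamily φ) : Aᶜ ∈ halfspaceFamily φ := by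
  obtain ⟨a, hpos, hneg⟩ := hA
  refine ⟨-a, fun x hx => ?_, fun x hx => ?_⟩
  · simpa using hneg x hx
  · simpa using hpos x (not_not.mp hx)

theorem card_le_of_shatters_halfspaceFamily {X κ : Type*} [Fintype κ] {φ : X → κ → ℝ}
    {S : Finset X} (hS : _root_.Shatters (halfspaceFamily φ) S) : S.card ≤ Fintype.card κ := by
  classical
  by_contra! hlt
  have hdep : ¬ LinearIndependent ℝ (fun x : S => φ x) := fun hli => by
    have := hli.fintype_card_le_finrank
    simp at this
    omega
  rw [Fintype.not_linearIndependent_iff] at hdep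
  obtain ⟨c, hc, x₀, hx₀⟩ := hdep
  obtain ⟨A, ⟨a, hpos, hneg⟩, hA⟩ := hS ((Finset.univ.filter fun x : S => 0 < c x).map
    (Function.Embedding.subtype _)) (fun x hx => by simp at hx; exact hx.1)
  have hmem : ∀ x : S, (x : X) ∈ A ↔ 0 < c x := by
    intro x
    have := Set.ext_iff.mp hA x
    simpa using this
  have hzero : ∑ x : S, c x * ∑ k, a k * φ x k = 0 := by
    have hk : ∀ k, ∑ x : S, c x * φ x k = 0 := fun k => by
      simpa using congrFun hc k
    calc ∑ x : S, c x * ∑ k, a k * φ x k = ∑ k, a k * ∑ x : S, c x * φ x k := by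
          simp only [Finset.mul_sum]
          rw [Finset.sum_comm]
          exact Finset.sum_congr rfl fun _ _ => Finset.sum_congr rfl fun _ _ => by ring
      _ = 0 := by simp only [hk, mul_zero, Finset.sum_const_zero]
  have hterm : ∀ x : S, c x ≠ 0 → 0 < c x * ∑ k, a k * φ x k := by
    intro x hx
    rcases hx.lt_or_gt with h | h
    · exact mul_pos_of_neg_of_neg h (hneg x fun hxA => h.not_gt ((hmem x).mp hxA))
    · exact mul_pos h (hpos x ((hmem x).mpr h))
  refine (Finset.sum_pos' (fun x _ => ?_) ⟨x₀, Finset.mem_univ _, hterm x₀ hx₀⟩).ne' hzero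
  by_cases hx : c x = 0
  · simp [hx]
  · exact (hterm x hx).le

theorem sum_choose_le_pow (m d : ℕ) :
    ((∑ k ∈ Finset.Iic d, m.choose k : ℕ) : ℝ) ≤ 4 ^ d * (5 / 4) ^ m := by
  have hexp : ((5 : ℝ) / 4) ^ m = ∑ k ∈ Finset.range (m + 1), (1 / 4) ^ k * (m.choose k : ℝ) := by
    rw [show (5 : ℝ) / 4 = 1 / 4 + 1 by norm_num, add_pow]
    simp
  calc ((∑ k ∈ Finset.Iic d, m.choose k : ℕ) : ℝ)
      ≤ ∑ k ∈ Finset.Iic d, 4 ^ d * ((1 / 4) ^ k * (m.choose k : ℝ)) := by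
        push_cast
        refine Finset.sum_le_sum fun k hk => ?_
        have h1 : (1 : ℝ) ≤ 4 ^ d * (1 / 4) ^ k := by
          rw [one_div, inv_pow, ← div_eq_mul_inv, one_le_div (by positivity)]
          exact pow_le_pow_right₀ (by norm_num) (Finset.mem_Iic.mp hk)
        rw [← mul_assoc]
        exact le_mul_of_one_le_left (by positivity) h1
    _ = 4 ^ d * ∑ k ∈ Finset.Iic d, (1 / 4) ^ k * (m.choose k : ℝ) := by rw [Finset.mul_sum]
    _ ≤ 4 ^ d * (5 / 4) ^ m := by
        rw [hexp]
        refine mul_le_mul_of_nonneg_left ?_ (by positivity)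
        have hsub : ∑ k ∈ Finset.range (m + 1), (1 / 4 : ℝ) ^ k * (m.choose k : ℝ) =
            ∑ k ∈ Finset.range (m + 1) ∪ Finset.Iic d, (1 / 4 : ℝ) ^ k * (m.choose k : ℝ) := by
          refine Finset.sum_subset Finset.subset_union_left fun k _ hk => ?_
          rw [Finset.mem_range, not_lt] at hk
          simp [Nat.choose_eq_zero_of_lt (show m < k by omega)]
        rw [hsub]
        exact Finset.sum_le_sum_of_subset_of_nonneg Finset.subset_union_right
          fun k _ _ => by positivity

/-- A union of `n` families of halfspaces with `n + 1` features has VC dimension at most `10 n`. -/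
theorem card_le_of_shatters_iUnion_halfspaceFamily {X κ : Type*} [Fintype κ] {n : ℕ}
    (hκ : Fintype.card κ = n + 1) {φ : Fin n → X → κ → ℝ} {S : Finset X}
    (hS : _root_.Shatters (⋃ i, halfspaceFamily (φ i)) S) : S.card ≤ 10 * n := by
  classical
  let traces : Fin n → Finset (Finset S) := fun i =>
    Finset.univ.filter fun T => ∃ A ∈ halfspaceFamily (φ i), ∀ x : S, x ∈ T ↔ (x : X) ∈ A
  have hcover : (Finset.univ : Finset (Finset S)) = Finset.univ.biUnion traces := by
    ext T
    obtain ⟨A, hA, hAT⟩ := hS (T.map (Function.Embedding.subtype _))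
      (fun x hx => by simp at hx; exact hx.1)
    obtain ⟨i, hi⟩ := Set.mem_iUnion.mp hA
    simp only [Finset.mem_univ, Finset.mem_biUnion, true_and, true_iff, traces, Finset.mem_filter]
    refine ⟨i, A, hi, fun x => ?_⟩
    have := Set.ext_iff.mp hAT x
    simpa using this.symm
  have hvc : ∀ i, (traces i).vcDim ≤ n + 1 := by
    intro i
    refine Finset.sup_le fun U hU => ?_
    rw [Finset.mem_shatterer] at hU
    rw [← hκ, ← Finset.card_map (Function.Embedding.subtype _)]
    refine card_le_of_shatters_halfspaceFamily (φ := φ i) fun T hT => ?_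
    obtain ⟨V, hV, hUV⟩ := hU (t := U.filter fun x => (x : X) ∈ T) (Finset.filter_subset _ _)
    obtain ⟨A, hA, hAV⟩ := (Finset.mem_filter.mp hV).2
    refine ⟨A, hA, Set.ext fun x => ⟨fun ⟨hxA, hxU⟩ => ?_, fun hxT => ?_⟩⟩
    · obtain ⟨y, hy, rfl⟩ := Finset.mem_map.mp (Finset.mem_coe.mp hxU)
      have : y ∈ U ∩ V := Finset.mem_inter.mpr ⟨hy, (hAV y).mpr hxA⟩
      rw [hUV] at this
      exact (Finset.mem_filter.mp this).2
    · obtain ⟨y, hy, rfl⟩ := Finset.mem_map.mp (hT (Finset.mem_coe.mp hxT))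
      have : y ∈ U ∩ V := hUV ▸ Finset.mem_filter.mpr ⟨hy, hxT⟩
      exact ⟨(hAV y).mp (Finset.mem_inter.mp this).2,
        Finset.mem_coe.mpr (Finset.mem_map_of_mem _ hy)⟩
  have hcard : ∀ i, ((traces i).card : ℝ) ≤ 4 ^ (n + 1) * (5 / 4) ^ S.card := by
    intro i
    refine le_trans ?_ (sum_choose_le_pow S.card (n + 1))
    have h1 := (traces i).card_le_card_shatterer.trans Finset.card_shatterer_le_sum_vcDim
    rw [Fintype.card_coe] at h1
    exact_mod_cast h1.trans (Finset.sum_le_sum_of_subset (Finset.Iic_subset_Iic.mpr (hvc i)))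
  have htotal : (2 : ℝ) ^ S.card ≤ n * (4 ^ (n + 1) * (5 / 4) ^ S.card) := by
    have h1 : 2 ^ S.card ≤ ∑ i, (traces i).card := by
      have := (congrArg Finset.card hcover).le.trans Finset.card_biUnion_le
      simpa using this
    calc (2 : ℝ) ^ S.card ≤ ∑ i, ((traces i).card : ℝ) := by exact_mod_cast h1
      _ ≤ ∑ _i : Fin n, (4 : ℝ) ^ (n + 1) * (5 / 4) ^ S.card :=
          Finset.sum_le_sum fun i _ => hcard i
      _ = n * (4 ^ (n + 1) * (5 / 4) ^ S.card) := by simp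
  by_contra! hlt
  have hn : (n : ℝ) ≤ 2 ^ n := by exact_mod_cast (Nat.lt_two_pow_self).le
  have hn0 : n ≠ 0 := by
    rintro rfl
    rw [Nat.cast_zero, zero_mul] at htotal
    exact htotal.not_gt (by positivity)
  have hbig : (4 : ℝ) * 8 ^ n < (8 / 5) ^ S.card := by
    calc (4 : ℝ) * 8 ^ n ≤ 8 ^ n * 8 ^ n := by
          gcongr
          exact le_trans (by norm_num) (le_self_pow₀ (by norm_num : (1 : ℝ) ≤ 8) hn0)
      _ = 64 ^ n := by rw [← mul_pow]; norm_num
      _ ≤ ((8 / 5) ^ 10) ^ n := by gcongr; norm_num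
      _ = (8 / 5) ^ (10 * n) := (pow_mul _ _ _).symm
      _ < (8 / 5) ^ S.card := pow_lt_pow_right₀ (by norm_num) hlt
  have hle : ((8 : ℝ) / 5) ^ S.card ≤ 4 * 8 ^ n := by
    have hpos : (0 : ℝ) < (5 / 4) ^ S.card := by positivity
    refine le_of_mul_le_mul_right ?_ hpos
    calc ((8 : ℝ) / 5) ^ S.card * (5 / 4) ^ S.card = 2 ^ S.card := by
          rw [← mul_pow]; norm_num
      _ ≤ n * (4 ^ (n + 1) * (5 / 4) ^ S.card) := htotal
      _ ≤ 2 ^ n * (4 ^ (n + 1) * (5 / 4) ^ S.card) := by gcongr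
      _ = 4 * 8 ^ n * (5 / 4) ^ S.card := by
          rw [show (8 : ℝ) = 2 * 4 by norm_num, mul_pow, pow_succ]; ring
  exact hle.not_gt hbig

/-- The features of `x` used to compare `q i` with the other distributions at `x`: a constant,
and for each `j` whether `j` precedes `i` when the indices are sorted by `q · x`. -/
noncomputable def precedenceFeatures {X : Type*} {n : ℕ} (q : Fin n → X → ℝ) (i : Fin n) (x : X) :
    Option (Fin n) → ℝ
  | none => 1
  | some j => if (Tuple.sort fun k => q k x).symm j < (Tuple.sort fun k => q k x).symm i
      then 1 else 0

theorem setOf_weightBefore_lt_mem_halfspaceFamily {X : Type*} [Finite X] {n : ℕ}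
    (q : Fin n → X → ℝ) (w : Fin n → ℝ) (i : Fin n) (c : ℝ) :
    {x | weightBefore (fun k => q k x) w i < c} ∈ halfspaceFamily (precedenceFeatures q i) := by
  have hev : ∀ᶠ c' in nhdsWithin c (Set.Iio c),
      c' < c ∧ ∀ x, weightBefore (fun k => q k x) w i < c →
        weightBefore (fun k => q k x) w i < c' := by
    refine Filter.Eventually.and self_mem_nhdsWithin (Filter.eventually_all.mpr fun x => ?_)
    by_cases hx : weightBefore (fun k => q k x) w i < c
    · filter_upwards [mem_nhdsWithin_of_mem_nhds (Ioi_mem_nhds hx)] with c' hc' _ using hc'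
    · exact Filter.Eventually.of_forall fun _ h => absurd h hx
  obtain ⟨c', hc', hlt⟩ := hev.exists
  have hsum : ∀ x, ∑ k : Option (Fin n),
      (k.elim c' fun j => -w j) * precedenceFeatures q i x k =
        c' - weightBefore (fun k => q k x) w i := by
    intro x
    simp only [Fintype.sum_option, Option.elim, precedenceFeatures, weightBefore, neg_mul,
      Finset.sum_neg_distrib]
    ring
  refine ⟨fun k => k.elim c' fun j => -w j, fun x hx => ?_, fun x hx => ?_⟩
  · rw [hsum]
    exact sub_pos.mpr (hlt x hx)
  · rw [hsum]
    exact sub_neg.mpr (hc'.trans_le (not_lt.mp hx))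

/-- The surrogate family: halfspaces in the precedence features of some index. -/
def surrogateFamily {X : Type*} {n : ℕ} (q : Fin n → X → ℝ) : Set (Set X) :=
  ⋃ i, halfspaceFamily (precedenceFeatures q i)

theorem sum_indicator_le_dFam {X : Type*} [Fintype X] {F : Set (Set X)} (p q : X → ℝ) {A : Set X}
    (hA : A ∈ F) : ∑ x, A.indicator (fun y => p y - q y) x ≤ dFam F p q :=
  le_ciSup (f := fun A : F => ∑ x, (A.1.indicator (fun y => p y - q y) x))
    (Set.finite_range _).bddAbove ⟨A, hA⟩

theorem dFam_le_tvFin {X : Type*} [Fintype X] (F : Set (Set X)) (p q : X → ℝ) :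
    dFam F p q ≤ tvFin p q := by
  classical
  have hle : ∀ A : Finset X, |∑ x ∈ A, (p x - q x)| ≤ tvFin p q :=
    le_ciSup (Set.finite_range _).bddAbove
  refine Real.iSup_le (fun A => ?_) ((abs_nonneg _).trans (hle ∅))
  refine le_trans (le_of_eq ?_) ((le_abs_self _).trans (hle (Finset.univ.filter (· ∈ A.1))))
  rw [Finset.sum_filter]
  exact Finset.sum_congr rfl fun x _ => by simp [Set.indicator_apply]

theorem tvFin_le {X : Type*} [Fintype X] {p q : X → ℝ} (hp : IsPMF p) (hq : IsPMF q) {v : ℝ}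
    (h : ∀ A : Finset X, ∑ x ∈ A, (p x - q x) ≤ v) : tvFin p q ≤ v := by
  classical
  refine ciSup_le fun A => abs_le'.mpr ⟨h A, ?_⟩
  have hsum := Finset.sum_add_sum_compl A fun x => p x - q x
  rw [Finset.sum_sub_distrib (s := Finset.univ), hp.2, hq.2, sub_self] at hsum
  linarith [h Aᶜ]

/-- If no distribution is within total variation `v i` of every `q i`, there are test functions
`g i : X → [0, w i]` witnessing this against all distributions simultaneously. -/
theorem exists_testFunctions_of_notMem_QTV {X : Type*} [Fintype X] {n : ℕ} {q : Fin n → X → ℝ}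
    (hq : ∀ i, IsPMF (q i)) {v : Fin n → ℝ} (hv : v ∉ QTV q) :
    ∃ (w : Fin n → ℝ) (g : Fin n → X → ℝ), (∀ i x, 0 ≤ g i x) ∧ (∀ i x, g i x ≤ w i) ∧
      ∀ x, ∑ i, w i * v i + ∑ i, ∑ y, q i y * g i y < ∑ i, g i x := by
  classical
  let T : (X → ℝ) → (Fin n × Finset X → ℝ) := fun p k => ∑ x ∈ k.2, (p x - q k.1 x) - v k.1
  have hconv : Convex ℝ (T '' stdSimplex ℝ X) := by
    rintro _ ⟨p, hp, rfl⟩ _ ⟨p', hp', rfl⟩ a b ha hb hab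
    refine ⟨a • p + b • p', convex_stdSimplex ℝ X hp hp' ha hb hab, ?_⟩
    ext k
    simp only [T, Pi.add_apply, Pi.smul_apply, smul_eq_mul, Finset.sum_sub_distrib,
      Finset.sum_add_distrib, ← Finset.mul_sum]
    linear_combination (∑ x ∈ k.2, q k.1 x + v k.1) * hab
  have hcomp : IsCompact (T '' stdSimplex ℝ X) :=
    (isCompact_stdSimplex ℝ X).image (by fun_prop)
  obtain ⟨c, hc0, hc⟩ := exists_nonneg_functional_pos hconv hcomp (by
    rintro _ ⟨p, hp, rfl⟩
    by_contra! hle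
    exact hv ⟨p, hp, fun i => tvFin_le hp (hq i) fun A => sub_nonpos.mp (hle (i, A))⟩)
  refine ⟨fun i => ∑ A, c (i, A), fun i x => ∑ A : Finset X, if x ∈ A then c (i, A) else 0,
    fun i x => Finset.sum_nonneg fun A _ => ?_, fun i x => Finset.sum_le_sum fun A _ => ?_,
    fun x => ?_⟩
  · split_ifs <;> simp [hc0]
  · split_ifs <;> simp [hc0]
  · have hx := hc _ ⟨Pi.single x 1, single_mem_stdSimplex ℝ x, rfl⟩
    rw [Fintype.sum_prod_type] at hx
    rw [← Finset.sum_add_distrib, ← sub_pos, ← Finset.sum_sub_distrib]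
    refine hx.trans_eq (Finset.sum_congr rfl fun i _ => ?_)
    have hswap : ∑ y, q i y * ∑ A : Finset X, (if y ∈ A then c (i, A) else 0) =
        ∑ A : Finset X, c (i, A) * ∑ y ∈ A, q i y := by
      simp only [Finset.mul_sum]
      rw [Finset.sum_comm]
      refine Finset.sum_congr rfl fun A _ => ?_
      simp [mul_ite, mul_comm]
    rw [hswap, Finset.sum_mul, ← Finset.sum_add_distrib, ← Finset.sum_sub_distrib]
    refine Finset.sum_congr rfl fun A _ => ?_
    have hsingle : ∑ y ∈ A, (Pi.single x 1 : X → ℝ) y = if x ∈ A then 1 else 0 := by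
      simp [Pi.single_apply]
    simp only [T, Finset.sum_sub_distrib, hsingle]
    split_ifs <;> ring

theorem QFam_surrogateFamily_subset_QTV {X : Type*} [Fintype X] [Nonempty X] {n : ℕ}
    {q : Fin n → X → ℝ} (hq : ∀ i, IsPMF (q i)) : QFam (surrogateFamily q) q ⊆ QTV q := by
  rintro v ⟨p, hp, hpv⟩
  by_contra hv
  obtain ⟨w, g, hg0, hgw, hlt⟩ := exists_testFunctions_of_notMem_QTV hq hv
  obtain ⟨x₀, hx₀⟩ := Finite.exists_min fun x => ∑ i, g i x
  set t := ∑ i, g i x₀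
  have ht0 : 0 ≤ t := Finset.sum_nonneg fun i _ => hg0 i x₀
  have hw : ∀ i, 0 ≤ w i := fun i => (hg0 i x₀).trans (hgw i x₀)
  have htw : t ≤ ∑ i, w i := Finset.sum_le_sum fun i _ => hgw i x₀
  let f : Fin n → X → ℝ := fun i x => greedyFill (fun k => q k x) w t i
  have hcost : ∑ i, ∑ y, q i y * f i y ≤ ∑ i, ∑ y, q i y * g i y := by
    rw [Finset.sum_comm, Finset.sum_comm (f := fun i y => q i y * g i y)]
    exact Finset.sum_le_sum fun y _ => sum_mul_greedyFill_le (fun i => (hq i).1 y) hw ht0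
      (fun i => hg0 i y) (fun i => hgw i y) (hx₀ y)
  have hp_sum : ∑ i, ∑ y, p y * f i y = t := by
    rw [Finset.sum_comm]
    simp only [← Finset.mul_sum, f, sum_greedyFill ht0 htw]
    rw [← Finset.sum_mul, hp.2, one_mul]
  have hgap : ∑ i, ∑ y, (p y - q i y) * f i y ≤ ∑ i, w i * v i := by
    refine Finset.sum_le_sum fun i _ => sum_mul_le_of_superlevel_le _ _ (hw i)
      (fun x => greedyFill_nonneg hw i) (fun x => greedyFill_le hw i) fun s hs hsw => ?_
    refine (sum_indicator_le_dFam p (q i) (Set.mem_iUnion.mpr ⟨i, ?_⟩)).trans (hpv i)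
    simp only [f, lt_greedyFill_iff hs hsw]
    exact setOf_weightBefore_lt_mem_halfspaceFamily q w i (t - s)
  simp only [sub_mul, Finset.sum_sub_distrib] at hgap
  linarith [hlt x₀]

/-- **Static surrogate family.** For distributions `q_1, …, q_n` on a finite set there is
a family `F` of subsets, closed under complementation, with `Q_TV = Q_F` and VC
dimension at most `10n`. -/
theorem static_surrogate_family {X : Type*} [Fintype X] [Nonempty X]
    (n : ℕ) (q : Fin n → X → ℝ) (hq : ∀ i, IsPMF (q i)) :
    ∃ F : Set (Set X),
      (∀ A ∈ F, Aᶜ ∈ F) ∧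
      QTV q = QFam F q ∧
      ∀ S : Finset X, Shatters F S → S.card ≤ 10 * n := by
  refine ⟨surrogateFamily q, fun A hA => ?_, Set.Subset.antisymm ?_ ?_, fun S hS => ?_⟩
  · obtain ⟨i, hi⟩ := Set.mem_iUnion.mp hA
    exact Set.mem_iUnion.mpr ⟨i, compl_mem_halfspaceFamily hi⟩
  · rintro v ⟨p, hp, hpv⟩
    exact ⟨p, hp, fun i => (dFam_le_tvFin _ p (q i)).trans (hpv i)⟩
  · exact QFam_surrogateFamily_subset_QTV hq
  · exact card_le_of_shatters_iUnion_halfspaceFamily (by simp) hS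
end
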